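/- arXiv:math/0312482 — 3 statements merged into one kernel-verified Lean document; each statement's English description precedes it below -/
import Mathlib

section
/- Let G be a finite simple graph on vertex set W with a partition W = W_1 ∪ … ∪ W_m into m nonempty color classes. If for every nonempty subset I ⊆ {1,…,m} the vector domination number of the induced subgraph satisfies Γ(G[∪_{i∈I} W_i]) > |I| − 1, then G contains a colorful independent set, i.e. an independent set S with S ∩ W_i ≠ ∅ for all 1 ≤ i ≤ m. -/
open Finset
open scoped ENNReal
/-- A vector representation of `G`: an assignment of vectors to the vertices with
`P(u)·P(v) ≥ 1` for adjacent `u, v` and `P(u)·P(v) ≥ 0` for non-adjacent `u, v`. -/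
def SimpleGraph.IsVectorRep {V : Type*} (G : SimpleGraph V) {ι : Type*} [Fintype ι]
    (P : V → ι → ℝ) : Prop :=
  (∀ u v : V, G.Adj u v → 1 ≤ ∑ i, P u i * P v i) ∧
  (∀ u v : V, ¬ G.Adj u v → 0 ≤ ∑ i, P u i * P v i)
/-- The value `|P|` of a vector representation: the infimum of `∑_v α(v)` over nonnegative
`α` with `∑_v α(v) P(v)·P(u) ≥ 1` for every vertex `u` (`= ⊤` if no such `α` exists). -/
noncomputable def repValue {V : Type*} [Fintype V] {ι : Type*} [Fintype ι]
    (P : V → ι → ℝ) : ℝ≥0∞ :=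
  sInf {x : ℝ≥0∞ | ∃ α : V → ℝ, (∀ v, 0 ≤ α v) ∧
    (∀ u : V, 1 ≤ ∑ v, α v * ∑ i, P v i * P u i) ∧ x = ENNReal.ofReal (∑ v, α v)}

/-- `Γ(G)`: the supremum of `|P|` over all vector representations `P` of `G`. -/
noncomputable def SimpleGraph.vecGamma {V : Type*} [Fintype V] (G : SimpleGraph V) : ℝ≥0∞ :=
  sSup {x : ℝ≥0∞ | ∃ (ℓ : ℕ) (P : V → Fin ℓ → ℝ), G.IsVectorRep P ∧ x = repValue P}

theorem nonpos_of_forall_add_mul_nonpos {a b : ℝ} (h : ∀ r : ℝ, 0 ≤ r → a + r * b ≤ 0) :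
    b ≤ 0 := by
  by_contra! hb
  have h1 := h ((|a| + 1) / b) (by positivity)
  rw [div_mul_cancel₀ _ hb.ne'] at h1
  linarith [neg_abs_le a]

/-- A form of linear programming duality: if every feasible point of the covering program has
value more than `κ`, then some strictly feasible point of the packing program does too. -/
theorem exists_packing_of_covering {V : Type*} [Fintype V] (M : V → V → ℝ) (κ : ℝ)
    (h : ∀ α : V → ℝ, (∀ v, 0 ≤ α v) → (∀ u, 1 ≤ ∑ v, α v * M v u) → κ < ∑ v, α v) :
    ∃ β : V → ℝ, (∀ v, 0 ≤ β v) ∧ (∀ u, ∑ v, M u v * β v < 1) ∧ κ < ∑ v, β v := by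
  classical
  by_contra! hno
  set K : Set ((V → ℝ) × ℝ) := {p | ∃ β : V → ℝ, (∀ v, 0 ≤ β v) ∧
    (∀ u, p.1 u < 1 - ∑ v, M u v * β v) ∧ p.2 < ∑ v, β v - κ} with hK
  have hconv : Convex ℝ K := by
    rintro p ⟨β, hβ, hp, hp'⟩ q ⟨γ, hγ, hq, hq'⟩ a b ha hb hab
    refine ⟨fun v => a * β v + b * γ v, fun v => ?_, fun u => ?_, ?_⟩
    · have := mul_nonneg ha (hβ v)
      have := mul_nonneg hb (hγ v)
      positivity
    · have e : 1 - ∑ v, M u v * (a * β v + b * γ v)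
          = a * (1 - ∑ v, M u v * β v) + b * (1 - ∑ v, M u v * γ v) := by
        have : ∑ v, M u v * (a * β v + b * γ v)
            = a * ∑ v, M u v * β v + b * ∑ v, M u v * γ v := by
          rw [mul_sum, mul_sum, ← sum_add_distrib]
          exact sum_congr rfl fun v _ => by ring
        rw [this]; linear_combination -hab
      rw [e]
      have hpu := hp u
      have hqu := hq u
      simp only [Prod.fst_add, Prod.smul_fst, Pi.add_apply, Pi.smul_apply, smul_eq_mul]
      rcases ha.eq_or_lt with rfl | ha'
      · obtain rfl : b = 1 := by linarith
        simpa using hqu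
      · have h1 := mul_lt_mul_of_pos_left hpu ha'
        have h2 := mul_le_mul_of_nonneg_left hqu.le hb
        linarith
    · have e : ∑ v, (a * β v + b * γ v) - κ
          = a * (∑ v, β v - κ) + b * (∑ v, γ v - κ) := by
        rw [sum_add_distrib, ← mul_sum, ← mul_sum]
        linear_combination κ * hab
      rw [e]
      simp only [Prod.snd_add, Prod.smul_snd, smul_eq_mul]
      rcases ha.eq_or_lt with rfl | ha'
      · obtain rfl : b = 1 := by linarith
        simpa using hq'
      · have h1 := mul_lt_mul_of_pos_left hp' ha'
        have h2 := mul_le_mul_of_nonneg_left hq'.le hb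
        linarith
  have hopen : IsOpen K := by
    have : K = ⋃ β : V → ℝ, ⋃ _ : ∀ v, 0 ≤ β v, ({p | ∀ u, p.1 u < 1 - ∑ v, M u v * β v} ∩
        {p | p.2 < ∑ v, β v - κ}) := by
      ext p; simp [hK, and_left_comm]
    rw [this]
    refine isOpen_iUnion fun β => isOpen_iUnion fun _ => IsOpen.inter ?_ ?_
    · rw [Set.ofPred_forall]
      exact isOpen_iInter_of_finite fun u => isOpen_lt (by fun_prop) (by fun_prop)
    · exact isOpen_lt (by fun_prop) (by fun_prop)
  have h0 : (0 : (V → ℝ) × ℝ) ∉ K := by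
    rintro ⟨β, hβ, h1, h2⟩
    have := hno β hβ fun u => by simpa using h1 u
    simp only [Prod.snd_zero] at h2
    linarith
  obtain ⟨f, hf⟩ := geometric_hahn_banach_open_point hconv hopen h0
  rw [map_zero] at hf
  set α : V → ℝ := fun u => f (Pi.single u 1, 0) with hα
  set μ : ℝ := f (0, 1) with hμ
  have hfe : ∀ (y : V → ℝ) (s : ℝ), f (y, s) = ∑ u, y u * α u + s * μ := by
    intro y s
    have : (y, s) = ∑ u, y u • ((Pi.single u 1, 0) : (V → ℝ) × ℝ) + s • (0, 1) := by
      ext w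
      · simp [Prod.fst_sum, Finset.sum_apply, Pi.single_apply]
      · simp [Prod.snd_sum]
    rw [this, map_add, map_sum, map_smul]
    simp only [map_smul, smul_eq_mul, hα, hμ]
  have hlt : ∀ β : V → ℝ, (∀ v, 0 ≤ β v) → ∀ (y : V → ℝ) (s : ℝ),
      (∀ u, y u < 1 - ∑ v, M u v * β v) → s < ∑ v, β v - κ →
      ∑ u, y u * α u + s * μ < 0 := fun β hβ y s hy hs => by
    rw [← hfe]; exact hf _ ⟨β, hβ, hy, hs⟩
  have hα0 : ∀ u, 0 ≤ α u := by
    intro u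
    rw [← neg_nonpos]
    refine nonpos_of_forall_add_mul_nonpos (a := ∑ u : V, 0 * α u + (-κ - 1) * μ) fun r hr => ?_
    have := hlt 0 (by simp) (fun w => 0 - r * (Pi.single u 1 : V → ℝ) w) (-κ - 1)
      (fun w => by
        have : 0 ≤ r * (Pi.single u 1 : V → ℝ) w :=
          mul_nonneg hr (by by_cases hw : w = u <;> simp [hw])
        simp; linarith) (by simp)
    simp only [sub_mul, sum_sub_distrib] at this
    simp only [Pi.single_apply, mul_ite, mul_one, mul_zero, ite_mul, zero_mul, sum_ite_eq',
      mem_univ, if_true, sum_const_zero] at this ⊢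
    linarith
  have hμ0 : 0 ≤ μ := by
    rw [← neg_nonpos]
    refine nonpos_of_forall_add_mul_nonpos (a := ∑ u : V, 0 * α u + (-κ - 1) * μ) fun r hr => ?_
    have := hlt 0 (by simp) (fun w => 0) (-κ - 1 - r) (fun w => by simp) (by simp; linarith)
    linarith
  have hle : ∀ β : V → ℝ, (∀ v, 0 ≤ β v) →
      ∑ u, (1 - ∑ v, M u v * β v) * α u + (∑ v, β v - κ) * μ ≤ 0 := by
    intro β hβ
    have hS : 0 ≤ ∑ u, α u := sum_nonneg fun u _ => hα0 u
    refine le_of_forall_pos_le_add fun ε hε => ?_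
    set δ := ε / (∑ u, α u + μ + 1) with hδ
    have hδ0 : 0 < δ := by positivity
    have := hlt β hβ (fun u => (1 - ∑ v, M u v * β v) - δ) (∑ v, β v - κ - δ)
      (fun u => by linarith) (by linarith)
    have e : ∑ u, ((1 - ∑ v, M u v * β v) - δ) * α u
        = ∑ u, (1 - ∑ v, M u v * β v) * α u - δ * ∑ u, α u := by
      rw [mul_sum, ← sum_sub_distrib]
      exact sum_congr rfl fun u _ => by ring
    rw [e] at this
    have h3 : δ * (∑ u, α u + μ + 1) = ε := div_mul_cancel₀ _ (by positivity)
    nlinarith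
  have hμα : ∀ v, μ ≤ ∑ u, α u * M u v := by
    intro v
    rw [← sub_nonpos]
    refine nonpos_of_forall_add_mul_nonpos (a := ∑ u, α u - κ * μ) fun r hr => ?_
    have := hle (Pi.single v r) (fun w => by by_cases hw : w = v <;> simp [hw, hr])
    simp only [Pi.single_apply, mul_ite, mul_zero, sum_ite_eq', mem_univ, if_true] at this
    have e : ∑ u, (1 - M u v * r) * α u = ∑ u, α u - r * ∑ u, α u * M u v := by
      rw [mul_sum, ← sum_sub_distrib]
      exact sum_congr rfl fun u _ => by ring
    rw [e] at this
    linarith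
  have hακ : ∑ u, α u ≤ κ * μ := by
    have := hle 0 (by simp)
    simp at this
    linarith
  rcases hμ0.eq_or_lt with hμz | hμpos
  · have hz : ∀ u, α u = 0 := by
      rw [← hμz, mul_zero] at hακ
      intro u
      exact le_antisymm ((single_le_sum (fun u _ => hα0 u) (mem_univ u)).trans hακ) (hα0 u)
    have := hlt 0 (by simp) (fun w => 0) (-κ - 1) (fun w => by simp) (by simp)
    simp [← hμz] at this
  · have h1 := h (fun u => α u / μ) (fun u => div_nonneg (hα0 u) hμ0) (fun v => by
      have : ∑ u, α u / μ * M u v = (∑ u, α u * M u v) / μ := by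
        rw [sum_div]; exact sum_congr rfl fun u _ => by ring
      rw [this, le_div_iff₀ hμpos, one_mul]
      exact hμα v)
    rw [← sum_div, lt_div_iff₀ hμpos] at h1
    linarith

/-- Positive weights on the vertices extracted from a large vector domination number. -/
theorem exists_weights_of_lt_vecGamma {V : Type*} [Fintype V] (H : SimpleGraph V) (k : ℕ)
    (h : (k : ℝ≥0∞) < H.vecGamma) :
    ∃ (ℓ : ℕ) (P : V → Fin ℓ → ℝ) (β : V → ℝ), H.IsVectorRep P ∧ (∀ v, 0 < β v) ∧
      (∀ u, ∑ v, β v * ∑ i, P u i * P v i ≤ 1) ∧ (k : ℝ) < ∑ v, β v := by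
  obtain ⟨x, ⟨ℓ, P, hP, rfl⟩, hx⟩ := lt_sSup_iff.1 h
  obtain ⟨β, hβ, hM, hk⟩ := exists_packing_of_covering (fun u v => ∑ i, P u i * P v i) k (by
    intro α hα hα'
    by_contra! hle
    have hval : repValue P ≤ ENNReal.ofReal (∑ v, α v) := sInf_le ⟨α, hα, hα', rfl⟩
    refine hx.not_ge (hval.trans ?_)
    rw [← ENNReal.ofReal_natCast]
    exact ENNReal.ofReal_le_ofReal hle)
  have hev : ∀ᶠ δ : ℝ in nhdsWithin 0 (Set.Ioi 0), ∀ u,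
      ∑ v, (β v + δ) * ∑ i, P u i * P v i < 1 := by
    refine Filter.eventually_all.2 fun u => ?_
    have hc : Continuous fun δ : ℝ => ∑ v, (β v + δ) * ∑ i, P u i * P v i := by fun_prop
    refine ((hc.tendsto 0).eventually (gt_mem_nhds ?_)).filter_mono nhdsWithin_le_nhds
    simpa [mul_comm] using hM u
  obtain ⟨δ, hδ, hδ0⟩ := (hev.and self_mem_nhdsWithin).exists
  have hδ0 : 0 < δ := hδ0
  refine ⟨ℓ, P, fun v => β v + δ, hP, fun v => by linarith [hβ v], fun u => (hδ u).le,
    hk.trans_le (sum_le_sum fun v _ => by linarith)⟩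

section Chains

variable {W : Type*}

/-- Real functions on `k`-tuples that change sign when two entries are exchanged. -/
def IsAlternatingFun {k : ℕ} (f : (Fin k → W) → ℝ) : Prop :=
  ∀ i j, i ≠ j → ∀ t, f (t ∘ Equiv.swap i j) = -f t

/-- The `k`-tuples with all entries in `A` and no two entries adjacent. -/
def SimpleGraph.indepTuples (G : SimpleGraph W) (A : Set W) (k : ℕ) : Set (Fin k → W) :=
  {t | (∀ i, t i ∈ A) ∧ ∀ i j, ¬ G.Adj (t i) (t j)}

/-- The chains with `k` vertices of the independence complex of the subgraph induced on `A`. -/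
def SimpleGraph.indepChains (G : SimpleGraph W) (A : Set W) (k : ℕ) :
    Submodule ℝ ((Fin k → W) → ℝ) where
  carrier := {f | IsAlternatingFun f ∧ ∀ t, t ∉ G.indepTuples A k → f t = 0}
  add_mem' := by
    rintro f g ⟨hf, hf'⟩ ⟨hg, hg'⟩
    refine ⟨fun i j hij t => ?_, fun t ht => ?_⟩
    · simp [hf i j hij t, hg i j hij t]; ring
    · simp [hf' t ht, hg' t ht]
  zero_mem' := ⟨fun i j hij t => by simp, fun t ht => rfl⟩
  smul_mem' := by
    rintro a f ⟨hf, hf'⟩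
    refine ⟨fun i j hij t => ?_, fun t ht => ?_⟩
    · simp [hf i j hij t]
    · simp [hf' t ht]

theorem SimpleGraph.indepChains_mono {G : SimpleGraph W} {A B : Set W} (h : A ⊆ B) (k : ℕ) :
    G.indepChains A k ≤ G.indepChains B k := fun _ hf =>
  ⟨hf.1, fun t ht => hf.2 t fun h' => ht ⟨fun i => h (h'.1 i), h'.2⟩⟩

theorem cons_comp_swap_succ {k : ℕ} (v : W) (t : Fin k → W) (i j : Fin k) :
    (Fin.cons v t : Fin (k + 1) → W) ∘ Equiv.swap i.succ j.succ
      = Fin.cons v (t ∘ Equiv.swap i j) := by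
  funext l
  refine Fin.cases ?_ (fun l => ?_) l
  · simp [Equiv.swap_apply_of_ne_of_ne (Fin.succ_ne_zero i).symm (Fin.succ_ne_zero j).symm]
  · rw [Function.comp_apply, ← (Fin.succ_injective k).map_swap]
    simp

theorem cons_comp_swap_zero {k : ℕ} (v : W) (t : Fin k → W) (i : Fin k) :
    (Fin.cons v t : Fin (k + 1) → W) ∘ Equiv.swap 0 i.succ
      = Fin.cons (t i) (Function.update t i v) := by
  funext l
  refine Fin.cases ?_ (fun l => ?_) l
  · simp
  · by_cases h : l = i
    · subst h; simp
    · have : l.succ ≠ i.succ := fun e => h (Fin.succ_injective _ e)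
      simp [Equiv.swap_apply_of_ne_of_ne (Fin.succ_ne_zero l) this, h]

theorem cons_update_comp_swap {k : ℕ} (u v : W) (t : Fin k → W) (i : Fin k) :
    (Fin.cons v (Function.update t i u) : Fin (k + 1) → W) ∘ Equiv.swap 0 i.succ
      = Fin.cons u (Function.update t i v) := by
  rw [cons_comp_swap_zero]; simp

theorem comp_swap_mem_indepTuples {G : SimpleGraph W} {A : Set W} {k : ℕ} {t : Fin k → W}
    (i j : Fin k) : t ∘ Equiv.swap i j ∈ G.indepTuples A k ↔ t ∈ G.indepTuples A k := by
  refine ⟨fun h => ⟨fun l => ?_, fun l l' => ?_⟩, fun h => ⟨fun l => h.1 _, fun l l' => h.2 _ _⟩⟩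
  · simpa using h.1 (Equiv.swap i j l)
  · simpa using h.2 (Equiv.swap i j l) (Equiv.swap i j l')

theorem tail_mem_indepTuples {G : SimpleGraph W} {A : Set W} {k : ℕ} {v : W} {t : Fin k → W}
    (h : (Fin.cons v t : Fin (k + 1) → W) ∈ G.indepTuples A (k + 1)) :
    t ∈ G.indepTuples A k :=
  ⟨fun l => by simpa using h.1 l.succ, fun l l' => by simpa using h.2 l.succ l'.succ⟩

/-- The alternating coboundary. On alternating functions it is the usual signed sum over the
deletions of one entry; this form avoids the signs. -/
def altCoboundary {k : ℕ} (f : (Fin k → W) → ℝ) (τ : Fin (k + 1) → W) : ℝ :=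
  f (Fin.tail τ) - ∑ i, f (Function.update (Fin.tail τ) i (τ 0))

theorem altCoboundary_cons {k : ℕ} (f : (Fin k → W) → ℝ) (v : W) (t : Fin k → W) :
    altCoboundary f (Fin.cons v t) = f t - ∑ i, f (Function.update t i v) := by
  simp [altCoboundary]

theorem update_comp_swap {k : ℕ} (t : Fin k → W) (i j l : Fin k) (v : W) :
    Function.update (t ∘ Equiv.swap i j) l v
      = Function.update t (Equiv.swap i j l) v ∘ Equiv.swap i j := by
  rw [Function.update_comp_equiv]; simp

theorem IsAlternatingFun.altCoboundary {k : ℕ} {f : (Fin k → W) → ℝ} (hf : IsAlternatingFun f) :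
    IsAlternatingFun (altCoboundary f) := by
  have key : ∀ (i : Fin k) (v : W) (t : Fin k → W),
      _root_.altCoboundary f ((Fin.cons v t : Fin (k + 1) → W) ∘ Equiv.swap 0 i.succ)
        = -_root_.altCoboundary f (Fin.cons v t) := by
    intro i v t
    rw [cons_comp_swap_zero, altCoboundary_cons, altCoboundary_cons,
      ← add_sum_erase _ _ (mem_univ i), ← add_sum_erase _ (fun l => f (Function.update t l v))
        (mem_univ i)]
    have : ∑ l ∈ univ.erase i, f (Function.update (Function.update t i v) l (t i))
        = ∑ l ∈ univ.erase i, -f (Function.update t l v) := by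
      refine sum_congr rfl fun l hl => ?_
      have hli : l ≠ i := (mem_erase.1 hl).1
      rw [← hf i l hli.symm]
      congr 1
      funext x
      by_cases hx : x = l
      · subst hx; simp [hli.symm]
      · by_cases hx' : x = i
        · subst hx'; simp [hx]
        · simp [Equiv.swap_apply_of_ne_of_ne hx' hx, hx, hx']
    rw [this, sum_neg_distrib]
    simp
    ring
  intro i j hij τ
  obtain ⟨v, t, rfl⟩ : ∃ v t, τ = Fin.cons v t := ⟨τ 0, Fin.tail τ, (Fin.cons_self_tail τ).symm⟩
  revert hij
  refine Fin.cases ?_ (fun i => ?_) i <;> refine Fin.cases ?_ (fun j => ?_) j <;> intro hij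
  · exact absurd rfl hij
  · exact key j v t
  · rw [Equiv.swap_comm]; exact key i v t
  · have hij' : i ≠ j := fun e => hij (by rw [e])
    rw [cons_comp_swap_succ, altCoboundary_cons, altCoboundary_cons, hf i j hij']
    simp_rw [update_comp_swap, hf i j hij', sum_neg_distrib]
    rw [Equiv.sum_comp (Equiv.swap i j) fun l => f (Function.update t l v)]
    ring

theorem IsAlternatingFun.indicator {G : SimpleGraph W} {A : Set W} {k : ℕ}
    {f : (Fin k → W) → ℝ} (hf : IsAlternatingFun f) :
    (G.indepTuples A k).indicator f ∈ G.indepChains A k := by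
  classical
  refine ⟨fun i j hij t => ?_, fun t ht => Set.indicator_of_notMem ht f⟩
  simp only [Set.indicator_apply, comp_swap_mem_indepTuples, hf i j hij]
  split_ifs <;> simp

theorem prod_comp_update {k : ℕ} (β : W → ℝ) (i : Fin k) (v : W) (t : Fin k → W) :
    ∏ l, β (Function.update t i v l) = β v * ∏ l ∈ univ.erase i, β (t l) := by
  rw [← mul_prod_erase _ _ (mem_univ i), Function.update_self]
  congr 1
  exact prod_congr rfl fun l hl => by rw [Function.update_of_ne (mem_erase.1 hl).1]

variable [Fintype W]

/-- The boundary of a chain with respect to vertex weights `β`. -/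
def weightedBoundary (β : W → ℝ) {k : ℕ} (f : (Fin (k + 1) → W) → ℝ) (t : Fin k → W) : ℝ :=
  ∑ v, β v * f (Fin.cons v t)

/-- The chains whose weighted boundary vanishes, whichever entry is summed over. -/
def weightedCycles (β : W → ℝ) (k : ℕ) : Submodule ℝ ((Fin k → W) → ℝ) where
  carrier := {f | ∀ i t, ∑ v, β v * f (Function.update t i v) = 0}
  add_mem' := by
    intro f g hf hg i t
    simp [mul_add, sum_add_distrib, hf i t, hg i t]
  zero_mem' := by intro i t; simp
  smul_mem' := by
    intro a f hf i t
    have : ∑ v, β v * (a • f) (Function.update t i v)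
        = a * ∑ v, β v * f (Function.update t i v) := by
      rw [mul_sum]; exact sum_congr rfl fun v _ => by simp; ring
    rw [this, hf i t, mul_zero]


theorem weightedBoundary_mem_indepChains {G : SimpleGraph W} {A : Set W} (β : W → ℝ) {k : ℕ}
    {f : (Fin (k + 1) → W) → ℝ} (hf : f ∈ G.indepChains A (k + 1)) :
    weightedBoundary β f ∈ G.indepChains A k := by
  refine ⟨fun i j hij t => ?_, fun t ht => ?_⟩
  · simp only [weightedBoundary]
    rw [← sum_neg_distrib]
    refine sum_congr rfl fun v _ => ?_
    rw [← cons_comp_swap_succ, hf.1 _ _ fun e => hij (Fin.succ_injective _ e)]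
    ring
  · refine sum_eq_zero fun v _ => ?_
    rw [hf.2 _ fun h => ht (tail_mem_indepTuples h), mul_zero]

theorem weightedBoundary_mem_weightedCycles (β : W → ℝ) {k : ℕ}
    {f : (Fin (k + 1) → W) → ℝ} (hf : IsAlternatingFun f) :
    weightedBoundary β f ∈ weightedCycles β k := by
  intro i t
  have h1 : ∑ u, β u * weightedBoundary β f (Function.update t i u)
      = ∑ u, ∑ v, β u * (β v * f (Fin.cons v (Function.update t i u))) :=
    sum_congr rfl fun u _ => by rw [weightedBoundary, mul_sum]
  have h2 : ∑ u, ∑ v, β u * (β v * f (Fin.cons v (Function.update t i u)))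
      = -∑ u, ∑ v, β u * (β v * f (Fin.cons v (Function.update t i u))) := by
    conv_lhs => rw [sum_comm]
    rw [← sum_neg_distrib]
    refine sum_congr rfl fun u _ => ?_
    rw [← sum_neg_distrib]
    refine sum_congr rfl fun v _ => ?_
    rw [← cons_update_comp_swap v u t i, hf _ _ (Fin.succ_ne_zero i).symm]
    ring
  rw [h1]; linarith

theorem mem_weightedCycles_of_weightedBoundary_eq_zero {β : W → ℝ} {k : ℕ}
    {f : (Fin (k + 1) → W) → ℝ} (hf : IsAlternatingFun f) (h : weightedBoundary β f = 0) :
    f ∈ weightedCycles β (k + 1) := by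
  have h0 : ∀ τ, ∑ v, β v * f (Function.update τ 0 v) = 0 := fun τ => by
    have := congrFun h (Fin.tail τ)
    rw [weightedBoundary, Pi.zero_apply] at this
    rw [← this]
    refine sum_congr rfl fun v _ => ?_
    rw [← Fin.update_cons_zero (τ 0), Fin.cons_self_tail]
  intro i τ
  by_cases hi : i = 0
  · subst hi; exact h0 τ
  rw [← neg_eq_zero, ← sum_neg_distrib, ← h0 (τ ∘ Equiv.swap 0 i)]
  refine sum_congr rfl fun v _ => ?_
  rw [update_comp_swap, hf 0 i (Ne.symm hi), Equiv.swap_apply_left]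
  ring

/-- Exchanging an extra summation variable with the `i`-th entry of a tuple. -/
theorem sum_exchange {k : ℕ} (i : Fin k) (F : W → (Fin k → W) → ℝ) :
    ∑ t, ∑ v, F v t = ∑ t : Fin k → W, ∑ v, F (t i) (Function.update t i v) := by
  rw [← Fintype.sum_prod_type' (f := fun t v => F v t),
    ← Fintype.sum_prod_type' (f := fun t v => F (t i) (Function.update t i v))]
  have hinv : Function.Involutive
      fun p : (Fin k → W) × W => (Function.update p.1 i p.2, p.1 i) := by
    rintro ⟨t, v⟩; simp
  exact (Equiv.sum_comp hinv.toPerm fun p : (Fin k → W) × W => F p.2 p.1).symm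

theorem sum_exchange_prod {k : ℕ} (β : W → ℝ) (i : Fin k) (F : W → (Fin k → W) → ℝ) :
    ∑ t, ∑ v, (∏ l, β (t l)) * β v * F v t
      = ∑ t : Fin k → W, ∑ v, (∏ l, β (t l)) * β v * F (t i) (Function.update t i v) := by
  rw [sum_exchange i]
  refine sum_congr rfl fun t _ => sum_congr rfl fun v _ => ?_
  congr 1
  rw [prod_comp_update, ← mul_prod_erase univ (fun l => β (t l)) (mem_univ i)]
  ring

/-- The exchange form of a symmetric nonnegative kernel is nonnegative. -/
theorem sum_kernel_exchange_nonneg {k : ℕ} {β : W → ℝ} (i : Fin k) {q : W → W → ℝ}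
    (hsymm : ∀ u v, q u v = q v u) (f : (Fin k → W) → ℝ)
    (hq : ∀ (t : Fin k → W) (v : W), 0 ≤ (∏ l, β (t l)) * β v * q v (t i)) :
    0 ≤ ∑ t : Fin k → W, ∑ v, (∏ l, β (t l)) * β v *
      (q v (t i) * (f t ^ 2 - f t * f (Function.update t i v))) := by
  have h1 := sum_exchange_prod β i fun v t =>
    q v (t i) * (f t ^ 2 - f t * f (Function.update t i v))
  have h2 : 0 ≤ ∑ t : Fin k → W, ∑ v, (∏ l, β (t l)) * β v * q v (t i) *
      (f t - f (Function.update t i v)) ^ 2 :=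
    sum_nonneg fun t _ => sum_nonneg fun v _ => mul_nonneg (hq t v) (sq_nonneg _)
  have h3 : ∑ t : Fin k → W, ∑ v, (∏ l, β (t l)) * β v * q v (t i) *
        (f t - f (Function.update t i v)) ^ 2
      = ∑ t : Fin k → W, ∑ v, (∏ l, β (t l)) * β v *
          (q v (t i) * (f t ^ 2 - f t * f (Function.update t i v)))
        + ∑ t : Fin k → W, ∑ v, (∏ l, β (t l)) * β v * (q (t i) (Function.update t i v i) *
          (f (Function.update t i v) ^ 2 - f (Function.update t i v) *
            f (Function.update (Function.update t i v) i (t i)))) := by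
    rw [← sum_add_distrib]
    refine sum_congr rfl fun t _ => ?_
    rw [← sum_add_distrib]
    refine sum_congr rfl fun v _ => ?_
    simp only [Function.update_self, Function.update_idem, Function.update_eq_self]
    rw [hsymm (t i) v]
    ring
  rw [← h1] at h3
  linarith

/-- The exchange form of a Gram kernel is positive semidefinite. -/
theorem sum_gram_exchange_nonneg {k ℓ : ℕ} {β : W → ℝ} (hβ : ∀ v, 0 ≤ β v)
    (hB : 0 < ∑ v, β v) (i : Fin k) (P : W → Fin ℓ → ℝ) (f : (Fin k → W) → ℝ) :
    0 ≤ ∑ t : Fin k → W, ∑ v, (∏ l, β (t l)) * β v *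
      ((∑ a, P v a * P (t i) a) * (f t * f (Function.update t i v))) := by
  set y : Fin ℓ → (Fin k → W) → ℝ :=
    fun a t => ∑ v, β v * (P v a * f (Function.update t i v)) with hy
  have hyu : ∀ a t u, y a (Function.update t i u) = y a t := by
    intro a t u; simp [hy]
  have h1 : ∑ t : Fin k → W, ∑ v, (∏ l, β (t l)) * β v *
      ((∑ a, P v a * P (t i) a) * (f t * f (Function.update t i v)))
      = ∑ a, ∑ t : Fin k → W, (∏ l, β (t l)) * (P (t i) a * f t * y a t) := by
    conv_rhs => rw [sum_comm]
    refine sum_congr rfl fun t _ => ?_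
    simp only [hy, mul_sum, sum_mul]
    rw [sum_comm]
    refine sum_congr rfl fun a _ => sum_congr rfl fun v _ => ?_
    ring
  rw [h1]
  refine sum_nonneg fun a _ => ?_
  refine nonneg_of_mul_nonneg_right (a := ∑ v, β v) ?_ hB
  have h2 : (∑ v, β v) * ∑ t : Fin k → W, (∏ l, β (t l)) * (P (t i) a * f t * y a t)
      = ∑ t : Fin k → W, ∑ v, (∏ l, β (t l)) * β v * (P (t i) a * f t * y a t) := by
    rw [mul_sum]
    refine sum_congr rfl fun t _ => ?_
    rw [sum_mul]
    exact sum_congr rfl fun v _ => by ring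
  have h3 : ∑ t : Fin k → W, ∑ v, (∏ l, β (t l)) * β v * (P (t i) a * f t * y a t)
      = ∑ t : Fin k → W, (∏ l, β (t l)) * y a t ^ 2 := by
    rw [sum_exchange_prod β i fun v t => P (t i) a * f t * y a t]
    refine sum_congr rfl fun t _ => ?_
    simp only [hyu, Function.update_self]
    rw [sq]
    nth_rewrite 2 [hy]
    rw [sum_mul, mul_sum]
    exact sum_congr rfl fun v _ => by ring
  rw [h2, h3]
  exact sum_nonneg fun t _ => mul_nonneg (prod_nonneg fun l _ => hβ _) (sq_nonneg _)

/-- The spectral gap: a cycle annihilated by the upper Laplacian is zero. -/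
theorem eq_zero_of_laplacian_eq_zero {G : SimpleGraph W} {A : Set W} {β : W → ℝ} {k ℓ : ℕ}
    {P : W → Fin ℓ → ℝ} (hβ : ∀ v, 0 ≤ β v) (hβA : ∀ v, 0 < β v ↔ v ∈ A)
    (hP0 : ∀ u v, 0 ≤ ∑ a, P u a * P v a)
    (hP1 : ∀ u ∈ A, ∀ v ∈ A, G.Adj u v → 1 ≤ ∑ a, P u a * P v a)
    (hPβ : ∀ u ∈ A, ∑ v, β v * ∑ a, P u a * P v a ≤ 1) (hk : (k : ℝ) < ∑ v, β v)
    {f : (Fin k → W) → ℝ} (hf : f ∈ G.indepChains A k) (hfc : f ∈ weightedCycles β k)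
    (hL : weightedBoundary β ((G.indepTuples A (k + 1)).indicator (altCoboundary f)) = 0) :
    f = 0 := by
  classical
  set w : (Fin k → W) → ℝ := fun t => ∏ l, β (t l) with hw
  have hw0 : ∀ t, 0 ≤ w t := fun t => prod_nonneg fun l _ => hβ _
  have hB : 0 < ∑ v, β v := lt_of_le_of_lt (Nat.cast_nonneg k) hk
  set X := G.indepTuples A (k + 1) with hX
  set adj : W → W → ℝ := fun u v => if G.Adj u v ∧ u ∈ A ∧ v ∈ A then 1 else 0 with hadj
  have hadjs : ∀ u v, adj u v = adj v u := by
    intro u v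
    simp only [hadj]
    congr 1
    rw [G.adj_comm, and_comm (a := u ∈ A)]
  have hadjM : ∀ u v, adj u v ≤ ∑ a, P u a * P v a := by
    intro u v
    simp only [hadj]
    split_ifs with h
    · exact hP1 u h.2.1 v h.2.2 h.1
    · exact hP0 u v
  -- multiplication of `f` by the total weight, as a sum over dependent tuples
  have hloc : ∀ t, (∑ v, β v) * f t ^ 2
      = ∑ v, β v * (f t * (if (Fin.cons v t : Fin (k + 1) → W) ∈ X then 0
          else altCoboundary f (Fin.cons v t))) := by
    intro t
    have h1 : ∑ v, β v * altCoboundary f (Fin.cons v t) = (∑ v, β v) * f t := by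
      simp only [altCoboundary_cons, mul_sub, sum_sub_distrib, mul_sum]
      rw [sum_comm, sum_mul]
      simp [hfc _ t]
    have h2 : ∑ v, β v * (if (Fin.cons v t : Fin (k + 1) → W) ∈ X
        then altCoboundary f (Fin.cons v t) else 0) = 0 := by
      have := congrFun hL t
      simpa only [weightedBoundary, Set.indicator_apply, Pi.zero_apply] using this
    have h3 : ∑ v, β v * (f t * (if (Fin.cons v t : Fin (k + 1) → W) ∈ X then 0
          else altCoboundary f (Fin.cons v t)))
        = f t * (∑ v, β v * altCoboundary f (Fin.cons v t)
          - ∑ v, β v * (if (Fin.cons v t : Fin (k + 1) → W) ∈ X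
            then altCoboundary f (Fin.cons v t) else 0)) := by
      rw [← sum_sub_distrib, mul_sum]
      refine sum_congr rfl fun v _ => ?_
      split_ifs <;> ring
    rw [h3, h1, h2]; ring
  have hpt : ∀ t, ∀ v ∈ A, f t * (if (Fin.cons v t : Fin (k + 1) → W) ∈ X then 0
      else altCoboundary f (Fin.cons v t))
        ≤ ∑ i, adj v (t i) * (f t ^ 2 - f t * f (Function.update t i v)) := by
    intro t v hv
    by_cases ht : t ∈ G.indepTuples A k
    swap
    · simp [hf.2 t ht]
    by_cases hvt : ∃ j, G.Adj v (t j)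
    · obtain ⟨j, hj⟩ := hvt
      have hnX : (Fin.cons v t : Fin (k + 1) → W) ∉ X := fun h =>
        h.2 0 j.succ (by simpa using hj)
      rw [if_neg hnX, altCoboundary_cons]
      have hzero : ∀ i, f (Function.update t i v)
          = adj v (t i) * f (Function.update t i v) := by
        intro i
        by_cases hi : G.Adj v (t i)
        · simp [hadj, hi, hv, ht.1 i]
        · have hij : j ≠ i := fun e => hi (e ▸ hj)
          rw [hf.2 (Function.update t i v) fun h => h.2 i j (by simpa [hij] using hj), mul_zero]
      have hsum : f t ^ 2 ≤ ∑ i, adj v (t i) * f t ^ 2 := by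
        have hle := single_le_sum (f := fun i => adj v (t i) * f t ^ 2)
          (fun i _ => mul_nonneg (by simp only [hadj]; split_ifs <;> norm_num) (sq_nonneg _))
          (mem_univ j)
        have h1 : adj v (t j) = 1 := by simp [hadj, hj, hv, ht.1 j]
        simpa [h1] using hle
      have he : ∑ i, adj v (t i) * (f t ^ 2 - f t * f (Function.update t i v))
          = ∑ i, adj v (t i) * f t ^ 2 - f t * ∑ i, f (Function.update t i v) := by
        rw [mul_sum, ← sum_sub_distrib]
        refine sum_congr rfl fun i _ => ?_
        nth_rewrite 2 [hzero i]
        ring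
      rw [he, mul_sub]
      linarith [sq (f t)]
    · push Not at hvt
      have hXm : (Fin.cons v t : Fin (k + 1) → W) ∈ X := by
        refine ⟨fun l => ?_, fun l l' => ?_⟩
        · refine Fin.cases ?_ (fun l => ?_) l
          · simpa using hv
          · simpa using ht.1 l
        · refine Fin.cases ?_ (fun l => ?_) l <;> refine Fin.cases ?_ (fun l' => ?_) l'
          · simp
          · simpa using hvt l'
          · simpa [G.adj_comm] using hvt l
          · simpa using ht.2 l l'
      rw [if_pos hXm, mul_zero]
      simp [hadj, hvt]
  have hupper : (∑ v, β v) * ∑ t, w t * f t ^ 2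
      ≤ ∑ i, ∑ t : Fin k → W, ∑ v, w t * β v *
        (adj v (t i) * (f t ^ 2 - f t * f (Function.update t i v))) := by
    rw [mul_sum, sum_comm]
    refine sum_le_sum fun t _ => ?_
    rw [mul_left_comm, hloc, mul_sum, sum_comm]
    refine sum_le_sum fun v _ => ?_
    rw [← mul_sum, mul_assoc]
    refine mul_le_mul_of_nonneg_left ?_ (hw0 t)
    by_cases hv : v ∈ A
    · exact mul_le_mul_of_nonneg_left (hpt t v hv) (hβ v)
    · have : β v = 0 := le_antisymm (not_lt.1 fun h => hv ((hβA v).1 h)) (hβ v)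
      simp [this]
  have hi : ∀ i, ∑ t : Fin k → W, ∑ v, w t * β v *
      (adj v (t i) * (f t ^ 2 - f t * f (Function.update t i v))) ≤ ∑ t, w t * f t ^ 2 := by
    intro i
    have h1 := sum_kernel_exchange_nonneg (β := β) i
      (q := fun u v => ∑ a, P u a * P v a - adj u v)
      (fun u v => by simp only [hadjs u v, mul_comm]) f
      (fun t v => mul_nonneg (mul_nonneg (hw0 t) (hβ v)) (sub_nonneg.2 (hadjM _ _)))
    have h2 := sum_gram_exchange_nonneg hβ hB i P f
    have h3 : ∑ t, ∑ v, w t * β v * ((∑ a, P v a * P (t i) a) * f t ^ 2)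
        ≤ ∑ t, w t * f t ^ 2 := by
      refine sum_le_sum fun t _ => ?_
      by_cases ht : t ∈ G.indepTuples A k
      · have e : ∑ v, w t * β v * ((∑ a, P v a * P (t i) a) * f t ^ 2)
            = w t * f t ^ 2 * ∑ v, β v * ∑ a, P (t i) a * P v a := by
          rw [mul_sum]
          refine sum_congr rfl fun v _ => ?_
          simp only [mul_comm (P v _)]
          ring
        rw [e]
        exact mul_le_of_le_one_right (mul_nonneg (hw0 t) (sq_nonneg _)) (hPβ _ (ht.1 i))
      · simp [hf.2 t ht]
    have h4 : ∑ t : Fin k → W, ∑ v, (∏ l, β (t l)) * β v *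
          ((∑ a, P v a * P (t i) a - adj v (t i)) * (f t ^ 2 - f t * f (Function.update t i v)))
        = ∑ t, ∑ v, w t * β v * ((∑ a, P v a * P (t i) a) * f t ^ 2)
          - ∑ t : Fin k → W, ∑ v, (∏ l, β (t l)) * β v *
            ((∑ a, P v a * P (t i) a) * (f t * f (Function.update t i v)))
          - ∑ t : Fin k → W, ∑ v, w t * β v *
            (adj v (t i) * (f t ^ 2 - f t * f (Function.update t i v))) := by
      simp only [← sum_sub_distrib]
      exact sum_congr rfl fun t _ => sum_congr rfl fun v _ => by simp only [hw]; ring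
    linarith
  have hN : ∑ t, w t * f t ^ 2 ≤ 0 := by
    have h1 : (∑ v, β v) * ∑ t, w t * f t ^ 2 ≤ k * ∑ t, w t * f t ^ 2 := by
      refine hupper.trans ((sum_le_sum fun i _ => hi i).trans ?_)
      simp
    by_contra! hpos
    exact absurd h1 (mul_lt_mul_of_pos_right hk hpos).not_ge
  funext t
  by_cases ht : t ∈ G.indepTuples A k
  · have h0 := (sum_eq_zero_iff_of_nonneg fun t _ => mul_nonneg (hw0 t) (sq_nonneg (f t))).1
      (le_antisymm hN (sum_nonneg fun t _ => mul_nonneg (hw0 t) (sq_nonneg (f t)))) t (mem_univ t)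
    have hwt : w t ≠ 0 := (prod_pos fun l _ => (hβA _).2 (ht.1 l)).ne'
    simpa [hwt] using h0
  · exact hf.2 t ht

/-- The weighted form of the vanishing of homology. -/
theorem exists_weightedBoundary_eq {G : SimpleGraph W} {A : Set W} {β : W → ℝ} {k ℓ : ℕ}
    {P : W → Fin ℓ → ℝ} (hβ : ∀ v, 0 ≤ β v) (hβA : ∀ v, 0 < β v ↔ v ∈ A)
    (hP0 : ∀ u v, 0 ≤ ∑ a, P u a * P v a)
    (hP1 : ∀ u ∈ A, ∀ v ∈ A, G.Adj u v → 1 ≤ ∑ a, P u a * P v a)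
    (hPβ : ∀ u ∈ A, ∑ v, β v * ∑ a, P u a * P v a ≤ 1) (hk : (k : ℝ) < ∑ v, β v)
    {z : (Fin k → W) → ℝ} (hz : z ∈ G.indepChains A k) (hzc : z ∈ weightedCycles β k) :
    ∃ b ∈ G.indepChains A (k + 1), weightedBoundary β b = z := by
  let L : ((Fin k → W) → ℝ) →ₗ[ℝ] ((Fin k → W) → ℝ) :=
    { toFun := fun f =>
        weightedBoundary β ((G.indepTuples A (k + 1)).indicator (altCoboundary f))
      map_add' := by
        intro f g
        have : altCoboundary (f + g) = altCoboundary f + altCoboundary g := by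
          funext τ; simp [altCoboundary, sum_add_distrib]; ring
        funext t
        simp [this, weightedBoundary, Set.indicator_add', mul_add, sum_add_distrib]
      map_smul' := by
        intro a f
        have : altCoboundary (a • f) = a • altCoboundary f := by
          funext τ; simp [altCoboundary, ← mul_sum, mul_sub]
        funext t
        have hs : (G.indepTuples A (k + 1)).indicator (a • altCoboundary f)
            = a • (G.indepTuples A (k + 1)).indicator (altCoboundary f) :=
          Set.indicator_const_smul _ a _
        rw [this, hs]
        simp [weightedBoundary, mul_sum, mul_left_comm] }
  have hL : ∀ f ∈ G.indepChains A k ⊓ weightedCycles β k,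
      L f ∈ G.indepChains A k ⊓ weightedCycles β k := fun f hf =>
    have hi := hf.1.1.altCoboundary.indicator (G := G) (A := A)
    ⟨weightedBoundary_mem_indepChains β hi, weightedBoundary_mem_weightedCycles β hi.1⟩
  have hinj : Function.Injective (L.restrict hL) := by
    rw [injective_iff_map_eq_zero]
    rintro ⟨f, hf⟩ h0
    exact Subtype.ext (eq_zero_of_laplacian_eq_zero hβ hβA hP0 hP1 hPβ hk hf.1 hf.2
      (congrArg Subtype.val h0))
  obtain ⟨⟨f, hf⟩, hfz⟩ := LinearMap.injective_iff_surjective.1 hinj ⟨z, hz, hzc⟩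
  exact ⟨_, hf.1.1.altCoboundary.indicator, congrArg Subtype.val hfz⟩

/-- If the vector domination number of the subgraph induced on `A` exceeds `k`, every cycle with
`k` vertices of its independence complex is a boundary. -/
theorem exists_boundary_eq_of_lt_vecGamma {G : SimpleGraph W} {A : Set W} [Fintype A] {k : ℕ}
    (h : (k : ℝ≥0∞) < (G.induce A).vecGamma) {z : (Fin k → W) → ℝ}
    (hz : z ∈ G.indepChains A k) (hzc : z ∈ weightedCycles 1 k) :
    ∃ b ∈ G.indepChains A (k + 1), weightedBoundary 1 b = z := by
  classical
  obtain ⟨ℓ, P, β, ⟨hP1, hP0⟩, hβ, hPβ, hk⟩ := exists_weights_of_lt_vecGamma _ k h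
  set β' : W → ℝ := fun v => if hv : v ∈ A then β ⟨v, hv⟩ else 0 with hβ'
  set P' : W → Fin ℓ → ℝ := fun v => if hv : v ∈ A then P ⟨v, hv⟩ else 0 with hP'
  have hβv : ∀ v : A, β' v = β v := fun v => by simp [hβ']
  have hPv : ∀ v : A, P' v = P v := fun v => by simp [hP']
  have hβn : ∀ v ∉ A, β' v = 0 := fun v hv => by simp [hβ', hv]
  have hPn : ∀ v ∉ A, P' v = 0 := fun v hv => by simp [hP', hv]
  have hsum : ∀ F : W → ℝ, ∑ v, β' v * F v = ∑ v : A, β v * F v := by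
    intro F
    rw [← sum_subset (subset_univ A.toFinset) fun v _ hv => by
      rw [hβn v (by simpa using hv), zero_mul],
      sum_subtype A.toFinset (p := (· ∈ A)) (fun v => Set.mem_toFinset)]
    exact sum_congr rfl fun v _ => by rw [hβv]
  have hβ0 : ∀ v, 0 ≤ β' v := fun v => by
    by_cases hv : v ∈ A
    · rw [hβv ⟨v, hv⟩]; exact (hβ _).le
    · rw [hβn v hv]
  have hβA : ∀ v, 0 < β' v ↔ v ∈ A := fun v => by
    by_cases hv : v ∈ A
    · simp [hβv ⟨v, hv⟩, hv, hβ]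
    · simp [hβn v hv, hv]
  have hw : ∀ {n : ℕ} {t : Fin n → W}, t ∈ G.indepTuples A n → ∏ i, β' (t i) ≠ 0 :=
    fun ht => (prod_pos fun i _ => (hβA _).2 (ht.1 i)).ne'
  have hprod : ∀ {n : ℕ} (i j : Fin n) (t : Fin n → W),
      ∏ l, β' ((t ∘ Equiv.swap i j) l) = ∏ l, β' (t l) := fun i j t =>
    Equiv.prod_comp (Equiv.swap i j) fun l => β' (t l)
  set g : (Fin k → W) → ℝ := fun t => z t / ∏ i, β' (t i) with hg
  have hgz : ∀ t, (∏ i, β' (t i)) * g t = z t := by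
    intro t
    by_cases ht : t ∈ G.indepTuples A k
    · exact mul_div_cancel₀ _ (hw ht)
    · simp [hg, hz.2 t ht]
  have hg1 : g ∈ G.indepChains A k := by
    refine ⟨fun i j hij t => ?_, fun t ht => by simp [hg, hz.2 t ht]⟩
    simp only [hg, hprod, hz.1 i j hij, neg_div]
  have hg2 : g ∈ weightedCycles β' k := by
    intro i t
    by_cases ht : ∀ l ∈ univ.erase i, t l ∈ A
    · have hne : ∏ l ∈ univ.erase i, β' (t l) ≠ 0 :=
        (prod_pos fun l hl => (hβA _).2 (ht l hl)).ne'
      refine (mul_eq_zero.1 ?_).resolve_left hne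
      rw [← hzc i t, mul_sum]
      refine sum_congr rfl fun v _ => ?_
      rw [← hgz, prod_comp_update, Pi.one_apply]
      ring
    · push Not at ht
      obtain ⟨l, hl, hlA⟩ := ht
      refine sum_eq_zero fun v _ => ?_
      rw [hg1.2 _ fun h => hlA ?_, mul_zero]
      simpa [(mem_erase.1 hl).1] using h.1 l
  obtain ⟨b, hb, hbg⟩ := exists_weightedBoundary_eq (P := P') hβ0 hβA
    (fun u v => by
      by_cases hu : u ∈ A
      · by_cases hv : v ∈ A
        · rw [hPv ⟨u, hu⟩, hPv ⟨v, hv⟩]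
          by_cases huv : (G.induce A).Adj ⟨u, hu⟩ ⟨v, hv⟩
          · exact zero_le_one.trans (hP1 _ _ huv)
          · exact hP0 _ _ huv
        · simp [hPn v hv]
      · simp [hPn u hu])
    (fun u hu v hv huv => by
      rw [hPv ⟨u, hu⟩, hPv ⟨v, hv⟩]
      exact hP1 _ _ (by simpa using huv))
    (fun u hu => by
      rw [hsum]
      simpa only [hPv, hPv ⟨u, hu⟩] using hPβ ⟨u, hu⟩)
    (by simpa using hk.trans_eq (by simpa using (hsum 1).symm)) hg1 hg2
  refine ⟨fun τ => (∏ l, β' (τ l)) * b τ, ⟨fun i j hij t => ?_, fun t ht => ?_⟩, ?_⟩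
  · simp only [hprod, hb.1 i j hij]; ring
  · simp only [hb.2 t ht, mul_zero]
  · funext t
    rw [← hgz, ← hbg]
    simp only [weightedBoundary, Fin.prod_univ_succ, Fin.cons_zero, Fin.cons_succ, mul_sum]
    refine sum_congr rfl fun v _ => ?_
    simp
    ring

end Chains

section ListBoundary

variable {α E F : Type*} [AddCommGroup E] [AddCommGroup F]

/-- The alternating sum of a function over the lists obtained by deleting one entry. -/
def listBoundary : (List α → E) → List α → E
  | _, [] => 0
  | h, x :: s => h s - listBoundary (fun r => h (x :: r)) s

theorem listBoundary_sub (h g : List α → E) (s : List α) :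
    listBoundary (h - g) s = listBoundary h s - listBoundary g s := by
  induction s generalizing h g with
  | nil => simp [listBoundary]
  | cons x s ih =>
    have := ih (fun r => h (x :: r)) (fun r => g (x :: r))
    simp only [listBoundary, Pi.sub_apply]
    rw [show (fun r => h (x :: r) - g (x :: r))
      = (fun r => h (x :: r)) - fun r => g (x :: r) from rfl, this]
    abel

theorem listBoundary_listBoundary (h : List α → E) (s : List α) :
    listBoundary (listBoundary h) s = 0 := by
  induction s generalizing h with
  | nil => rfl
  | cons x s ih =>
    have e : (fun r => listBoundary h (x :: r)) = h - listBoundary fun r => h (x :: r) := rfl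
    rw [listBoundary, e, listBoundary_sub, ih]
    simp

theorem listBoundary_mem [Module ℝ E] (p : Submodule ℝ E) {h : List α → E} {s : List α}
    (hp : ∀ r, r.Sublist s → r.length + 1 = s.length → h r ∈ p) : listBoundary h s ∈ p := by
  induction s generalizing h with
  | nil => exact p.zero_mem
  | cons x s ih =>
    refine p.sub_mem (hp s (List.sublist_cons_self x s) rfl) (ih fun r hr hl => ?_)
    exact hp (x :: r) (hr.cons_cons x) (by simp [hl])

theorem map_listBoundary [Module ℝ E] [Module ℝ F] (L : E →ₗ[ℝ] F) (h : List α → E) (s : List α) :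
    L (listBoundary h s) = listBoundary (fun r => L (h r)) s := by
  induction s generalizing h with
  | nil => exact map_zero L
  | cons x s ih => rw [listBoundary, map_sub, ih]; rfl

theorem listBoundary_congr [Module ℝ E] {h g : List α → E} {s : List α}
    (hg : ∀ r, r.Sublist s → r.length + 1 = s.length → h r = g r) :
    listBoundary h s = listBoundary g s := by
  rw [← sub_eq_zero, ← listBoundary_sub, ← Submodule.mem_bot ℝ]
  exact listBoundary_mem _ fun r hr hl => by simp [hg r hr hl]

end ListBoundary

section Colorful

variable {W C : Type*} [Fintype W] [DecidableEq C]

/-- The linear map underlying the unweighted boundary. -/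
def boundaryHom (W : Type*) [Fintype W] (k : ℕ) :
    ((Fin (k + 1) → W) → ℝ) →ₗ[ℝ] ((Fin k → W) → ℝ) where
  toFun := weightedBoundary 1
  map_add' f g := by funext t; simp [weightedBoundary, sum_add_distrib]
  map_smul' a f := by funext t; simp [weightedBoundary, mul_sum]

/-- The sum of a chain over the tuples with a prescribed list of colours. -/
def colorSum (c : W → C) {k : ℕ} (s : List C) (f : (Fin k → W) → ℝ) : ℝ :=
  ∑ t : Fin k → W, if List.ofFn (fun i => c (t i)) = s then f t else 0

/-- Taking the boundary preserves the number of rainbow tuples, counted with coefficients. -/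
theorem colorSum_weightedBoundary (c : W → C) {k : ℕ} {G : SimpleGraph W} {x : C} {s : List C}
    (hs : (x :: s).Nodup) {f : (Fin (k + 1) → W) → ℝ}
    (hf : f ∈ G.indepChains {w | c w ∈ x :: s} (k + 1)) :
    colorSum c s (weightedBoundary 1 f) = colorSum c (x :: s) f := by
  classical
  have hx : x ∉ s := (List.nodup_cons.1 hs).1
  have h1 : colorSum c (x :: s) f = ∑ t : Fin k → W, ∑ v,
      if List.ofFn (fun i => c (t i)) = s ∧ c v = x then f (Fin.cons v t) else 0 := by
    rw [colorSum, ← (Fin.consEquiv fun _ : Fin (k + 1) => W).sum_comp, Fintype.sum_prod_type,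
      sum_comm]
    refine sum_congr rfl fun t _ => sum_congr rfl fun v _ => ?_
    simp [Fin.consEquiv, List.ofFn_succ, and_comm]
  have h2 : colorSum c s (weightedBoundary 1 f) = ∑ t : Fin k → W, ∑ v,
      if List.ofFn (fun i => c (t i)) = s then f (Fin.cons v t) else 0 := by
    refine sum_congr rfl fun t _ => ?_
    split_ifs <;> simp [weightedBoundary]
  have h3 : ∀ i : Fin k, ∑ t : Fin k → W, ∑ v,
      (if List.ofFn (fun i => c (t i)) = s ∧ c v = c (t i) then f (Fin.cons v t) else 0) = 0 := by
    intro i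
    have hex := sum_exchange i fun v (t : Fin k → W) =>
      if List.ofFn (fun i => c (t i)) = s ∧ c v = c (t i) then f (Fin.cons v t) else 0
    have hneg : ∑ t : Fin k → W, ∑ v,
        (if List.ofFn (fun l => c (Function.update t i v l)) = s ∧
          c (t i) = c (Function.update t i v i) then
          f (Fin.cons (t i) (Function.update t i v)) else 0)
        = -∑ t : Fin k → W, ∑ v,
          (if List.ofFn (fun i => c (t i)) = s ∧ c v = c (t i) then f (Fin.cons v t) else 0) := by
      rw [← sum_neg_distrib]
      refine sum_congr rfl fun t _ => ?_
      rw [← sum_neg_distrib]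
      refine sum_congr rfl fun v _ => ?_
      rw [Function.update_self]
      by_cases hcv : c v = c (t i)
      · have : (fun l => c (Function.update t i v l)) = fun l => c (t l) := by
          funext l
          by_cases hl : l = i
          · subst hl; simp [hcv]
          · simp [hl]
        rw [this, ← cons_comp_swap_zero, hf.1 _ _ (Fin.succ_ne_zero i).symm]
        simp only [hcv, and_true]
        split_ifs <;> simp
      · simp [hcv, Ne.symm hcv]
    linarith
  have h4 : ∀ (t : Fin k → W) (v : W),
      (if List.ofFn (fun i => c (t i)) = s then f (Fin.cons v t) else 0)
      = (if List.ofFn (fun i => c (t i)) = s ∧ c v = x then f (Fin.cons v t) else 0)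
        + ∑ i, if List.ofFn (fun i => c (t i)) = s ∧ c v = c (t i) then f (Fin.cons v t)
          else 0 := by
    intro t v
    by_cases ht : List.ofFn (fun i => c (t i)) = s
    swap
    · simp [ht]
    simp only [ht, true_and, if_true]
    have hmem : ∀ i, c (t i) ∈ s := fun i => ht ▸ List.mem_ofFn.2 ⟨i, rfl⟩
    by_cases hvx : c v = x
    · rw [if_pos hvx, sum_eq_zero, add_zero]
      intro i _
      rw [if_neg]
      rintro e
      exact hx (hvx ▸ e ▸ hmem i)
    · rw [if_neg hvx, zero_add]
      by_cases hvs : c v ∈ s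
      · obtain ⟨i, hi⟩ := List.mem_ofFn.1 (ht ▸ hvs)
        have hinj : Function.Injective fun i => c (t i) :=
          List.nodup_ofFn.1 (ht ▸ (List.nodup_cons.1 hs).2)
        rw [sum_eq_single i]
        · rw [if_pos hi.symm]
        · intro j _ hj
          rw [if_neg]
          intro e
          exact hj (hinj (e.symm.trans hi.symm))
        · simp
      · have : f (Fin.cons v t) = 0 := hf.2 _ fun h => by
          have := h.1 0
          simp [hvx, hvs] at this
        simp [this]
  rw [h1, h2]
  simp only [h4, sum_add_distrib]
  rw [add_eq_left]
  simp_rw [sum_comm (s := (univ : Finset W)) (t := (univ : Finset (Fin k)))]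
  rw [sum_comm]
  exact sum_eq_zero fun i _ => h3 i

theorem colorSum_listBoundary (c : W → C) {k : ℕ} {G : SimpleGraph W} {x : C} {s : List C}
    (hs : (x :: s).Nodup) {φ : List C → (Fin k → W) → ℝ}
    (hφ : ∀ r : List C, r.Nodup → r.length = s.length → φ r ∈ G.indepChains {w | c w ∈ r} k) :
    colorSum c s (listBoundary φ (x :: s)) = colorSum c s (φ s) := by
  refine sum_congr rfl fun t _ => ?_
  split_ifs with ht
  swap
  · rfl
  rw [listBoundary, Pi.sub_apply, sub_eq_self]
  refine listBoundary_mem (LinearMap.ker (LinearMap.proj (R := ℝ) (φ := fun _ => ℝ) t))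
    fun r hr hl => ?_
  rw [LinearMap.mem_ker, LinearMap.proj_apply]
  have hxr : (x :: r).Nodup := hs.sublist (hr.cons_cons x)
  refine (hφ _ hxr (by simpa using hl)).2 t fun h => ?_
  have hsub : s ⊆ r := by
    intro y hy
    obtain ⟨i, rfl⟩ := List.mem_ofFn.1 (ht ▸ hy)
    have hne : c (t i) ≠ x := fun e => (List.nodup_cons.1 hs).1 (e ▸ hy)
    simpa [hne] using h.1 i
  have := ((List.nodup_cons.1 hs).2.subperm hsub).length_le
  omega

/-- A chain map from the full simplex on the colours to the independence complex, one dimension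
at a time. -/
theorem exists_colored_chains (G : SimpleGraph W) (c : W → C)
    (hacyc : ∀ s : List C, s.Nodup → ∀ k : ℕ, s.length = k + 1 →
      ∀ z ∈ G.indepChains {w | c w ∈ s} k, z ∈ weightedCycles 1 k →
        ∃ b ∈ G.indepChains {w | c w ∈ s} (k + 1), weightedBoundary 1 b = z) (k : ℕ) :
    ∃ φ : List C → (Fin k → W) → ℝ,
      (∀ s : List C, s.Nodup → s.length = k →
        φ s ∈ G.indepChains {w | c w ∈ s} k ∧ colorSum c s (φ s) = 1) ∧
      ∀ s : List C, s.Nodup → s.length = k + 1 → listBoundary φ s ∈ weightedCycles 1 k := by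
  induction k with
  | zero =>
    refine ⟨fun _ _ => 1, fun s _ hs => ⟨⟨fun i => i.elim0, fun t ht => ?_⟩, ?_⟩,
      fun s _ _ i => i.elim0⟩
    · exact absurd ⟨fun i => i.elim0, fun i => i.elim0⟩ ht
    · simp [colorSum, List.length_eq_zero_iff.1 hs]
  | succ k ih =>
    obtain ⟨φ, hφ, hcyc⟩ := ih
    have hmem : ∀ s : List C, s.Nodup → s.length = k + 1 →
        listBoundary φ s ∈ G.indepChains {w | c w ∈ s} k := fun s hs hl =>
      listBoundary_mem _ fun r hr hrl => G.indepChains_mono (fun _ hw => hr.subset hw) k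
        (hφ r (hs.sublist hr) (by omega)).1
    have hex : ∀ s : List C, ∃ b : (Fin (k + 1) → W) → ℝ, s.Nodup → s.length = k + 1 →
        b ∈ G.indepChains {w | c w ∈ s} (k + 1) ∧ weightedBoundary 1 b = listBoundary φ s := by
      intro s
      by_cases hs : s.Nodup ∧ s.length = k + 1
      · obtain ⟨b, hb⟩ := hacyc s hs.1 k hs.2 _ (hmem s hs.1 hs.2) (hcyc s hs.1 hs.2)
        exact ⟨b, fun _ _ => hb⟩
      · exact ⟨0, fun h1 h2 => absurd ⟨h1, h2⟩ hs⟩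
    choose ψ hψ using hex
    refine ⟨ψ, fun s hs hl => ⟨(hψ s hs hl).1, ?_⟩, fun s hs hl => ?_⟩
    · cases s with
      | nil => simp at hl
      | cons x s =>
        have hl' : s.length = k := by simpa using hl
        rw [← colorSum_weightedBoundary c hs (hψ _ hs hl).1, (hψ _ hs hl).2,
          colorSum_listBoundary c hs fun r hr hrl => (hφ r hr (hrl.trans hl')).1]
        exact (hφ s (List.nodup_cons.1 hs).2 hl').2
    · have halt : listBoundary ψ s ∈ G.indepChains {w | c w ∈ s} (k + 1) :=
        listBoundary_mem _ fun r hr hrl => G.indepChains_mono (fun _ hw => hr.subset hw) _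
          (hψ r (hs.sublist hr) (by omega)).1
      have h0 : weightedBoundary 1 (listBoundary ψ s) = 0 := by
        refine (map_listBoundary (boundaryHom W k) ψ s).trans ?_
        rw [← listBoundary_listBoundary φ s]
        exact listBoundary_congr fun r hr hrl => (hψ r (hs.sublist hr) (by omega)).2
      exact mem_weightedCycles_of_weightedBoundary_eq_zero halt.1 h0

end Colorful

/-- **Theorem 5.2** (Aharoni–Berger–Meshulam): let `G` be a graph on a vertex set `W`
partitioned into nonempty colour classes `W_1, …, W_m` (given by a surjective colouring
`c : W → Fin m`).  If `Γ(G[⋃_{i∈I} W_i]) > |I| − 1` for every nonempty `I ⊆ {1,…,m}`,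
then `G` contains a colourful independent set. -/
theorem exists_colorful_indepSet {W : Type*} [Fintype W] [DecidableEq W] (G : SimpleGraph W)
    (m : ℕ) (c : W → Fin m) (hc : Function.Surjective c)
    (h : ∀ I : Finset (Fin m), I.Nonempty →
      ((I.card : ℝ≥0∞) - 1) < (G.induce {w : W | c w ∈ I}).vecGamma) :
    ∃ S : Finset W, (∀ u ∈ S, ∀ v ∈ S, ¬ G.Adj u v) ∧ ∀ i : Fin m, ∃ w ∈ S, c w = i := by
  have hacyc : ∀ s : List (Fin m), s.Nodup → ∀ k : ℕ, s.length = k + 1 →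
      ∀ z ∈ G.indepChains {w | c w ∈ s} k, z ∈ weightedCycles 1 k →
        ∃ b ∈ G.indepChains {w | c w ∈ s} (k + 1), weightedBoundary 1 b = z := by
    intro s hs k hk z hz hzc
    have hcard : s.toFinset.card = k + 1 := by rw [List.toFinset_card_of_nodup hs, hk]
    have hlt := h s.toFinset (card_pos.1 (by omega))
    rw [hcard, Nat.cast_succ, ENNReal.add_sub_cancel_right ENNReal.one_ne_top] at hlt
    have hA : {w | c w ∈ s} = {w | c w ∈ s.toFinset} := by ext w; simp
    rw [hA] at hz ⊢
    exact exists_boundary_eq_of_lt_vecGamma hlt hz hzc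
  obtain ⟨φ, hφ, -⟩ := exists_colored_chains G c hacyc m
  obtain ⟨hmem, hsum⟩ := hφ (List.finRange m) (List.nodup_finRange m) List.length_finRange
  obtain ⟨t, -, ht⟩ := exists_ne_zero_of_sum_ne_zero
    (show colorSum c (List.finRange m) (φ (List.finRange m)) ≠ 0 by rw [hsum]; exact one_ne_zero)
  have htc : List.ofFn (fun i => c (t i)) = List.finRange m := by
    by_contra hne; exact ht (if_neg hne)
  rw [if_pos htc] at ht
  have htX : t ∈ G.indepTuples {w | c w ∈ List.finRange m} m := by
    by_contra hne; exact ht (hmem.2 t hne)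
  refine ⟨univ.image t, ?_, fun i => ?_⟩
  · simp only [mem_image, mem_univ, true_and]
    rintro _ ⟨i, rfl⟩ _ ⟨j, rfl⟩
    exact htX.2 i j
  · obtain ⟨j, hj⟩ := List.mem_ofFn.1 (htc ▸ List.mem_finRange i)
    exact ⟨t j, mem_image_of_mem t (mem_univ j), hj⟩
end

section
/- Let F_1,…,F_m be finite hypergraphs on a finite ground set V. If for every nonempty subset I ⊆ {1,…,m} the fractional width satisfies w*(∪_{i∈I} F_i) > |I| − 1, then the family F_1,…,F_m has a system of disjoint representatives, i.e. there exist pairwise disjoint edges E_1 ∈ F_1, …, E_m ∈ F_m. -/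
open Finset
open scoped ENNReal
/-- The fractional width `w*(F)` of a hypergraph `F`: the infimum of `∑_{E∈F} f(E)` over
nonnegative `f : F → ℝ` such that `∑_{F'∈F} f(F')·|E ∩ F'| ≥ 1` for every edge `E ∈ F`
(`= ⊤` if no such `f` exists). -/
noncomputable def fracWidth {V : Type*} [DecidableEq V] (F : Finset (Finset V)) : ℝ≥0∞ :=
  sInf {x : ℝ≥0∞ | ∃ f : Finset V → ℝ, (∀ E, 0 ≤ f E) ∧
    (∀ E ∈ F, 1 ≤ ∑ F' ∈ F, f F' * ((E ∩ F').card : ℝ)) ∧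
    x = ENNReal.ofReal (∑ E ∈ F, f E)}


section OrientedChains

variable {T : Type*} [LinearOrder T]

/-- The incidence sign of adjoining the vertex `v` to the face `σ` of an ordered simplex. -/
def incidenceSign (v : T) (σ : Finset T) : ℝ := (-1) ^ #{x ∈ σ | x < v}

lemma incidenceSign_mul_self (v : T) (σ : Finset T) :
    incidenceSign v σ * incidenceSign v σ = 1 := by
  simp [incidenceSign, ← mul_pow]

lemma incidenceSign_sq (v : T) (σ : Finset T) : incidenceSign v σ ^ 2 = 1 := by
  rw [sq, incidenceSign_mul_self]

lemma incidenceSign_insert_of_lt {u v : T} {σ : Finset T} (hu : u ∉ σ) (h : u < v) :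
    incidenceSign v (insert u σ) = -incidenceSign v σ := by
  have : u ∉ ({x ∈ σ | x < v} : Finset T) := fun h' => hu (mem_filter.1 h').1
  simp [incidenceSign, filter_insert, h, card_insert_of_notMem this, pow_succ]

lemma incidenceSign_insert_of_not_lt {u v : T} {σ : Finset T} (h : ¬ u < v) :
    incidenceSign v (insert u σ) = incidenceSign v σ := by
  simp [incidenceSign, filter_insert, h]

lemma incidenceSign_swap {u v : T} {ρ : Finset T} (huv : u ≠ v) (hu : u ∉ ρ) (hv : v ∉ ρ) :
    incidenceSign u ρ * incidenceSign v (insert u ρ) =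
      -(incidenceSign v ρ * incidenceSign u (insert v ρ)) := by
  rcases lt_or_gt_of_ne huv with h | h
  · rw [incidenceSign_insert_of_lt hu h, incidenceSign_insert_of_not_lt h.not_gt]; ring
  · rw [incidenceSign_insert_of_lt hv h, incidenceSign_insert_of_not_lt h.not_gt]; ring

lemma sum_sum_eq_zero_of_antisymm {ι E : Type*} [AddCommGroup E] [Module ℝ E] (s : Finset ι)
    (g : ι → ι → E) (hg : ∀ i ∈ s, ∀ j ∈ s, g i j = -g j i) :
    ∑ i ∈ s, ∑ j ∈ s, g i j = 0 := by
  have h : ∑ i ∈ s, ∑ j ∈ s, g i j = -∑ i ∈ s, ∑ j ∈ s, g i j := by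
    conv_rhs => rw [sum_comm]
    simp only [← sum_neg_distrib]
    exact sum_congr rfl fun i hi => sum_congr rfl fun j hj => hg i hi j hj
  have h2 : (2 : ℝ) • ∑ i ∈ s, ∑ j ∈ s, g i j = 0 := by
    rw [two_smul]
    exact add_eq_zero_iff_eq_neg.2 h
  rw [← inv_smul_smul₀ (two_ne_zero (α := ℝ)) (∑ i ∈ s, ∑ j ∈ s, g i j), h2, smul_zero]

lemma sum_incidenceSign_erase_erase {E : Type*} [AddCommGroup E] [Module ℝ E] (I : Finset T)
    (x : Finset T → E) :
    ∑ i ∈ I, incidenceSign i (I.erase i) • ∑ j ∈ I.erase i,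
      incidenceSign j ((I.erase i).erase j) • x ((I.erase i).erase j) = 0 := by
  rw [← sum_sum_eq_zero_of_antisymm I (fun i j => if i = j then 0 else
    (incidenceSign i (I.erase i) * incidenceSign j ((I.erase i).erase j)) •
      x ((I.erase i).erase j))]
  · refine sum_congr rfl fun i hi => ?_
    rw [smul_sum, ← add_sum_erase I _ hi, if_pos rfl, zero_add]
    refine sum_congr rfl fun j hj => ?_
    rw [if_neg (ne_of_mem_erase hj).symm, smul_smul]
  · intro i hi j hj
    by_cases hij : i = j
    · simp [hij]
    rw [if_neg hij, if_neg (Ne.symm hij), erase_right_comm (a := j), ← neg_smul]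
    congr 1
    have h1 : I.erase i = insert j ((I.erase i).erase j) :=
      (insert_erase (mem_erase.2 ⟨Ne.symm hij, hj⟩)).symm
    have h2 : I.erase j = insert i ((I.erase i).erase j) := by
      rw [erase_right_comm, insert_erase (mem_erase.2 ⟨hij, hi⟩)]
    have := incidenceSign_swap (ρ := (I.erase i).erase j) hij (by simp) (by simp)
    rw [← h1, ← h2] at this
    linarith

variable [Fintype T]

lemma sum_sum_mem_eq_sum_sum_compl {E : Type*} [AddCommMonoid E] (g : T → Finset T → E) :
    ∑ τ : Finset T, ∑ u ∈ τ, g u (τ.erase u) = ∑ ρ : Finset T, ∑ u ∈ ρᶜ, g u ρ := by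
  rw [sum_sigma', sum_sigma']
  refine sum_bij' (fun x _ => ⟨x.1.erase x.2, x.2⟩) (fun x _ => ⟨insert x.2 x.1, x.2⟩)
    ?_ ?_ ?_ ?_ ?_
  · simp
  · simp
  · rintro ⟨τ, u⟩ h
    simp at h
    simp [insert_erase h]
  · rintro ⟨τ, u⟩ h
    simp at h
    simp [erase_insert h]
  · simp

/-- The boundary operator on oriented chains of the full simplex on `T`, with the vertex `v`
weighted by `w v`. -/
def contract (w : T → ℝ) : (Finset T → ℝ) →ₗ[ℝ] (Finset T → ℝ) where
  toFun φ ρ := ∑ v ∈ ρᶜ, incidenceSign v ρ * (w v * φ (insert v ρ))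
  map_add' φ ψ := by ext ρ; simp [mul_add, sum_add_distrib]
  map_smul' a φ := by
    ext ρ
    simp only [Pi.smul_apply, smul_eq_mul, mul_sum, RingHom.id_apply]
    exact sum_congr rfl fun _ _ => by ring

/-- The coboundary operator on oriented cochains of the full simplex on `T`. -/
def coboundary (φ : Finset T → ℝ) (τ : Finset T) : ℝ :=
  ∑ u ∈ τ, incidenceSign u (τ.erase u) * φ (τ.erase u)

lemma contract_apply (w : T → ℝ) (φ : Finset T → ℝ) (ρ : Finset T) :
    contract w φ ρ = ∑ v ∈ ρᶜ, incidenceSign v ρ * (w v * φ (insert v ρ)) := rfl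

lemma contract_contract (w : T → ℝ) (φ : Finset T → ℝ) : contract w (contract w φ) = 0 := by
  ext ρ
  simp only [contract_apply, Pi.zero_apply]
  rw [← sum_sum_eq_zero_of_antisymm ρᶜ (fun i j => if i = j then 0 else
    (incidenceSign i ρ * incidenceSign j (insert i ρ)) *
      (w i * w j * φ (insert j (insert i ρ))))]
  · refine sum_congr rfl fun i hi => ?_
    rw [mul_sum, mul_sum, ← add_sum_erase ρᶜ _ hi, if_pos rfl, zero_add, ← compl_insert]
    refine sum_congr rfl fun j hj => ?_
    rw [if_neg]
    · ring
    · rintro rfl; simp at hj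
  · intro i hi j hj
    by_cases hij : i = j
    · simp [hij]
    rw [if_neg hij, if_neg (Ne.symm hij),
      incidenceSign_swap hij (mem_compl.1 hi) (mem_compl.1 hj), insert_comm]
    ring

lemma sum_mul_coboundary (w : T → ℝ) (φ ψ : Finset T → ℝ) :
    ∑ τ, (∏ v ∈ τ, w v) * ψ τ * coboundary φ τ =
      ∑ ρ, (∏ v ∈ ρ, w v) * contract w ψ ρ * φ ρ := by
  have h := sum_sum_mem_eq_sum_sum_compl (fun u (ρ : Finset T) =>
    (∏ v ∈ insert u ρ, w v) * ψ (insert u ρ) * (incidenceSign u ρ * φ ρ))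
  calc _ = _ := sum_congr rfl fun τ _ => ?_
    _ = _ := h
    _ = _ := sum_congr rfl fun ρ _ => ?_
  · rw [coboundary, mul_sum]
    exact sum_congr rfl fun u hu => by rw [insert_erase hu]
  · rw [contract_apply, mul_sum, sum_mul]
    refine sum_congr rfl fun u hu => ?_
    rw [prod_insert (mem_compl.1 hu)]
    ring

lemma contract_coboundary_add (w : T → ℝ) (φ : Finset T → ℝ) (σ : Finset T) :
    contract w (coboundary φ) σ + coboundary (contract w φ) σ = (∑ v, w v) * φ σ := by
  have h1 : contract w (coboundary φ) σ = ∑ v ∈ σᶜ, w v * φ σ + ∑ v ∈ σᶜ, ∑ u ∈ σ,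
      incidenceSign v σ * (w v * (incidenceSign u ((insert v σ).erase u) *
        φ ((insert v σ).erase u))) := by
    rw [contract_apply, ← sum_add_distrib]
    refine sum_congr rfl fun v hv => ?_
    have hv := mem_compl.1 hv
    rw [coboundary, sum_insert hv, erase_insert hv, mul_add, mul_add, mul_sum, mul_sum]
    congr 1
    linear_combination (w v * φ σ) * incidenceSign_mul_self v σ
  have h2 : coboundary (contract w φ) σ = ∑ u ∈ σ, w u * φ σ + ∑ u ∈ σ, ∑ v ∈ σᶜ,
      incidenceSign u (σ.erase u) * (incidenceSign v (σ.erase u) * (w v *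
        φ (insert v (σ.erase u)))) := by
    rw [coboundary, ← sum_add_distrib]
    refine sum_congr rfl fun u hu => ?_
    rw [contract_apply, compl_erase, sum_insert (by simpa using hu), insert_erase hu, mul_add,
      mul_sum]
    congr 1
    linear_combination (w u * φ σ) * incidenceSign_mul_self u (σ.erase u)
  have h3 : ∑ v ∈ σᶜ, ∑ u ∈ σ,
      incidenceSign v σ * (w v * (incidenceSign u ((insert v σ).erase u) *
        φ ((insert v σ).erase u))) = -∑ u ∈ σ, ∑ v ∈ σᶜ,
      incidenceSign u (σ.erase u) * (incidenceSign v (σ.erase u) * (w v *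
        φ (insert v (σ.erase u)))) := by
    rw [sum_comm]
    simp only [← sum_neg_distrib]
    refine sum_congr rfl fun u hu => sum_congr rfl fun v hv => ?_
    have hv := mem_compl.1 hv
    have hvu : v ≠ u := fun h => hv (h ▸ hu)
    rw [erase_insert_of_ne hvu]
    have hs := incidenceSign_swap (ρ := σ.erase u) hvu (fun h => hv (mem_of_mem_erase h))
      (by simp)
    rw [insert_erase hu] at hs
    have hb := incidenceSign_mul_self u (insert v (σ.erase u))
    have hc := incidenceSign_mul_self u (σ.erase u)
    set a := incidenceSign v (σ.erase u)
    set b := incidenceSign u (insert v (σ.erase u))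
    set c := incidenceSign u (σ.erase u)
    set d := incidenceSign v σ
    have key : d * b = -(c * a) := by linear_combination -(d * b) * hc + b * c * hs - a * c * hb
    linear_combination (w v * φ (insert v (σ.erase u))) * key
  rw [h1, h2, h3, ← sum_add_sum_compl σ w, add_mul, sum_mul, sum_mul]
  ring

end OrientedChains

section LinearAlgebra

variable {ι : Type*} [Fintype ι]

lemma exists_mem_forall_weighted_orthogonal (p : ι → ℝ) (hp : ∀ i, 0 < p i)
    (W : Submodule ℝ (ι → ℝ)) (z : ι → ℝ) :
    ∃ b ∈ W, ∀ y ∈ W, ∑ i, p i * (z i - b i) * y i = 0 := by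
  let B : LinearMap.BilinForm ℝ (ι → ℝ) := LinearMap.mk₂ ℝ (fun x y => ∑ i, p i * x i * y i)
    (fun x x' y => by simp [mul_add, add_mul, sum_add_distrib])
    (fun c x y => by
      simp only [Pi.smul_apply, smul_eq_mul, mul_sum]
      exact sum_congr rfl fun _ _ => by ring)
    (fun x y y' => by simp [mul_add, sum_add_distrib])
    (fun c x y => by
      simp only [Pi.smul_apply, smul_eq_mul, mul_sum]
      exact sum_congr rfl fun _ _ => by ring)
  have hB : ∀ x y, B x y = ∑ i, p i * x i * y i := fun x y => rfl
  have hsymm : ∀ x y, B x y = B y x := fun x y => by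
    rw [hB, hB]
    exact sum_congr rfl fun _ _ => by ring
  have hrefl : B.IsRefl := fun x y h => by rw [hsymm, h]
  have hdisj : Disjoint W (B.orthogonal W) := by
    rw [Submodule.disjoint_def]
    intro x hx hx'
    have h0 : B x x = 0 := hx' x hx
    rw [hB, sum_eq_zero_iff_of_nonneg fun i _ => by
      rw [mul_assoc]; exact mul_nonneg (hp i).le (mul_self_nonneg _)] at h0
    ext i
    have := h0 i (mem_univ i)
    simpa [(hp i).ne'] using this
  have hcompl := (LinearMap.BilinForm.isCompl_orthogonal_iff_disjoint hrefl).2 hdisj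
  obtain ⟨b, hb, h, hh, rfl⟩ := Submodule.mem_sup.1
    (hcompl.sup_eq_top ▸ Submodule.mem_top : z ∈ W ⊔ B.orthogonal W)
  refine ⟨b, hb, fun y hy => ?_⟩
  have h0 : B y h = 0 := hh y hy
  rw [hsymm, hB] at h0
  simpa using h0

/-- A form of linear programming duality for covering and packing with a symmetric matrix. -/
lemma exists_fractional_packing [DecidableEq ι] [Nonempty ι] (M : ι → ι → ℝ)
    (hM : ∀ i j, M i j = M j i)
    {t : ℝ} (ht : 0 < t)
    (hcover : ∀ a : ι → ℝ, (∀ i, 0 ≤ a i) → (∀ i, 1 ≤ ∑ j, M i j * a j) → t < ∑ i, a i) :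
    ∃ b : ι → ℝ, (∀ i, 0 ≤ b i) ∧ (∀ i, ∑ j, M i j * b j ≤ 1) ∧ ∑ i, b i = t := by
  let L : (ι → ℝ) →ₗ[ℝ] (ι → ℝ) := Matrix.mulVecLin (Matrix.of M)
  have hL : ∀ x i, L x i = ∑ j, M i j * x j := fun x i => rfl
  by_cases hd : Disjoint (L '' stdSimplex ℝ ι) (Set.Iic fun _ => t⁻¹)
  · exfalso
    obtain ⟨f, u, v, hu, huv, hv⟩ := geometric_hahn_banach_compact_closed
      ((convex_stdSimplex ℝ ι).linear_image L)
      ((isCompact_stdSimplex ℝ ι).image L.continuous_of_finiteDimensional)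
      (convex_Iic _) isClosed_Iic hd
    let p : ι → ℝ := fun i => -f (Pi.single i 1)
    have hf : ∀ x, f x = -∑ i, p i * x i := fun x => by
      conv_lhs => rw [← univ_sum_single x, map_sum]
      rw [← sum_neg_distrib]
      refine sum_congr rfl fun i _ => ?_
      have : Pi.single i (x i) = x i • (Pi.single i 1 : ι → ℝ) := by
        rw [← Pi.single_smul, smul_eq_mul, mul_one]
      rw [this, map_smul, smul_eq_mul]
      simp [p, mul_comm]
    have hp : ∀ i, 0 ≤ p i := by
      intro i
      by_contra! hi
      obtain ⟨n, hn⟩ := exists_nat_gt ((f (fun _ => t⁻¹) - v) / -p i)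
      rw [div_lt_iff₀ (by linarith)] at hn
      have := hv ((fun _ => t⁻¹) - (n : ℝ) • Pi.single i 1) (by
        intro j
        simp only [Pi.sub_apply, Pi.smul_apply, smul_eq_mul]
        have : (0 : ℝ) ≤ (Pi.single i 1 : ι → ℝ) j := by
          by_cases h : j = i <;> simp [h]
        nlinarith [(Nat.cast_nonneg n : (0 : ℝ) ≤ n)])
      rw [map_sub, map_smul, smul_eq_mul] at this
      simp only [p] at hn hi
      nlinarith
    have hsum : ∀ j, t⁻¹ * ∑ i, p i < ∑ i, M j i * p i := by
      intro j
      have h1 := hu _ ⟨Pi.single j 1, single_mem_stdSimplex ℝ j, rfl⟩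
      have h2 := hv (fun _ => t⁻¹) (Set.mem_Iic.2 le_rfl)
      rw [hf] at h1 h2
      have h3 : ∑ i, p i * L (Pi.single j 1) i = ∑ i, M j i * p i :=
        sum_congr rfl fun i _ => by
          rw [hL, mul_comm, hM j i]
          simp [Pi.single_apply]
      rw [← sum_mul, mul_comm] at h2
      linarith
    have hP : 0 < ∑ i, p i := by
      refine (sum_nonneg fun i _ => hp i).lt_of_ne fun h => ?_
      have h0 : ∀ i, p i = 0 := fun i =>
        (sum_eq_zero_iff_of_nonneg fun i _ => hp i).1 h.symm i (mem_univ i)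
      obtain ⟨j⟩ := ‹Nonempty ι›
      simpa [h0] using hsum j
    have := hcover (fun i => t * (∑ i, p i)⁻¹ * p i) (fun i => by have := hp i; positivity)
      fun i => by
        have h1 := (hsum i).le
        have h2 : ∑ j, M i j * (t * (∑ i, p i)⁻¹ * p j) =
            t * (∑ i, p i)⁻¹ * ∑ j, M i j * p j := by
          rw [mul_sum]
          exact sum_congr rfl fun _ _ => by ring
        rw [h2]
        calc 1 = t * (∑ i, p i)⁻¹ * (t⁻¹ * ∑ i, p i) := by field_simp
          _ ≤ _ := by gcongr
    rw [← mul_sum, mul_assoc, inv_mul_cancel₀ hP.ne', mul_one] at this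
    exact this.false
  · obtain ⟨_, ⟨b, hb, rfl⟩, hb'⟩ := Set.not_disjoint_iff.1 hd
    refine ⟨fun i => t * b i, fun i => mul_nonneg ht.le (hb.1 i), fun i => ?_, ?_⟩
    · have h1 : L b i ≤ t⁻¹ := hb' i
      rw [hL] at h1
      calc ∑ j, M i j * (t * b j) = t * ∑ j, M i j * b j := by
            rw [mul_sum]
            exact sum_congr rfl fun _ _ => by ring
        _ ≤ t * t⁻¹ := by gcongr
        _ = 1 := mul_inv_cancel₀ ht.ne'
    · rw [← mul_sum, hb.2, mul_one]

lemma exists_pos_fractional_packing [DecidableEq ι] [Nonempty ι] (M : ι → ι → ℝ)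
    (hM : ∀ i j, M i j = M j i) (hM0 : ∀ i j, 0 ≤ M i j) {s t : ℝ} (hs : 0 ≤ s) (hst : s < t)
    (hcover : ∀ a : ι → ℝ, (∀ i, 0 ≤ a i) → (∀ i, 1 ≤ ∑ j, M i j * a j) → t < ∑ i, a i) :
    ∃ b : ι → ℝ, (∀ i, 0 < b i) ∧ (∀ i, ∑ j, M i j * b j ≤ 1) ∧ s < ∑ i, b i := by
  obtain ⟨b, hb, hb1, hbt⟩ := exists_fractional_packing M hM (hs.trans_lt hst) hcover
  set R := ∑ i, ∑ j, M i j
  have hR : 0 ≤ R := sum_nonneg fun i _ => sum_nonneg fun j _ => hM0 i j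
  obtain ⟨δ, hδ, hδ'⟩ : ∃ δ : ℝ, 0 < δ ∧ s * (1 + δ * R) < t := by
    refine ⟨(t - s) / ((s + 1) * (R + 1)), by have := sub_pos.2 hst; positivity, ?_⟩
    have h1 : s * R < (s + 1) * (R + 1) := by nlinarith
    have h2 : (t - s) / ((s + 1) * (R + 1)) * (s * R) < t - s := by
      rw [div_mul_eq_mul_div, div_lt_iff₀ (by positivity)]
      have := sub_pos.2 hst
      gcongr
    linarith
  have h1 : 0 < 1 + δ * R := by positivity
  refine ⟨fun i => (b i + δ) / (1 + δ * R), fun i => by have := hb i; positivity, fun i => ?_, ?_⟩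
  · have hRi : ∑ j, M i j ≤ R :=
      single_le_sum (f := fun i => ∑ j, M i j) (fun i _ => sum_nonneg fun j _ => hM0 i j)
        (mem_univ i)
    simp only [← mul_div_assoc]
    rw [← sum_div, div_le_one h1]
    simp only [mul_add, sum_add_distrib, ← sum_mul]
    nlinarith [hb1 i]
  · rw [← sum_div, lt_div_iff₀ h1, sum_add_distrib, hbt]
    have : 0 ≤ ∑ _i : ι, δ := sum_nonneg fun _ _ => hδ.le
    linarith

end LinearAlgebra

section IndependenceComplex

variable {T : Type*}

lemma coboundary_sq_le [LinearOrder T] (G : T → T → Prop) (M : T → T → ℝ)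
    (hM : ∀ u v, M u v = M v u)
    (hM0 : ∀ u v, 0 ≤ M u v) (hG : ∀ u v, G u v → 1 ≤ M u v) (φ : Finset T → ℝ)
    (hφ : ∀ σ, φ σ ≠ 0 → (σ : Set T).Pairwise fun u v => ¬ G u v) (τ : Finset T)
    (hτ : ¬ (τ : Set T).Pairwise fun u v => ¬ G u v) :
    2 * coboundary φ τ ^ 2 ≤ ∑ u ∈ τ, ∑ v ∈ τ.erase u, M u v *
      (incidenceSign u (τ.erase u) * φ (τ.erase u) +
        incidenceSign v (τ.erase v) * φ (τ.erase v)) ^ 2 := by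
  obtain ⟨a, ha, b, hb, hab, hGab⟩ :
      ∃ a ∈ τ, ∃ b ∈ τ, a ≠ b ∧ G a b := by
    simpa [Set.Pairwise] using hτ
  set x : T → ℝ := fun u => incidenceSign u (τ.erase u) * φ (τ.erase u) with hx
  have hx0 : ∀ u ∈ τ, u ∉ ({a, b} : Finset T) → x u = 0 := by
    intro u _ hu
    simp only [mem_insert, mem_singleton, not_or] at hu
    by_contra h
    exact hφ _ (right_ne_zero_of_mul h) (mem_coe.2 (mem_erase.2 ⟨Ne.symm hu.1, ha⟩))
      (mem_coe.2 (mem_erase.2 ⟨Ne.symm hu.2, hb⟩)) hab hGab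
  have hsub : ({a, b} : Finset T) ⊆ τ := by simp [insert_subset_iff, ha, hb]
  have h1 : coboundary φ τ = x a + x b := by
    rw [← sum_pair (f := x) hab]
    exact (sum_subset hsub hx0).symm
  have hnn : ∀ u v, 0 ≤ M u v * (x u + x v) ^ 2 := fun u v => mul_nonneg (hM0 u v) (sq_nonneg _)
  have h2 : ∀ u ∈ τ, ∀ v ∈ τ, u ≠ v →
      M u v * (x u + x v) ^ 2 ≤ ∑ v ∈ τ.erase u, M u v * (x u + x v) ^ 2 :=
    fun u _ v hv huv => single_le_sum (f := fun v => M u v * (x u + x v) ^ 2)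
      (fun v _ => hnn u v) (mem_erase.2 ⟨huv.symm, hv⟩)
  calc 2 * coboundary φ τ ^ 2 ≤ M a b * (x a + x b) ^ 2 + M b a * (x b + x a) ^ 2 := by
        have := hG a b hGab
        rw [h1, hM b a]
        nlinarith [sq_nonneg (x a + x b)]
    _ ≤ ∑ v ∈ τ.erase a, M a v * (x a + x v) ^ 2 + ∑ v ∈ τ.erase b, M b v * (x b + x v) ^ 2 :=
        add_le_add (h2 a ha b hb hab) (h2 b hb a ha hab.symm)
    _ = ∑ u ∈ {a, b}, ∑ v ∈ τ.erase u, M u v * (x u + x v) ^ 2 :=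
        (sum_pair (f := fun u => ∑ v ∈ τ.erase u, M u v * (x u + x v) ^ 2) hab).symm
    _ ≤ _ := sum_le_sum_of_subset_of_nonneg hsub fun u _ _ => sum_nonneg fun v _ => hnn u v

variable [Fintype T]

lemma sum_mul_sub_sq_le (M : T → T → ℝ) (hM : ∀ u v, M u v = M v u)
    (hpsd : ∀ g : T → ℝ, 0 ≤ ∑ u, ∑ v, M u v * (g u * g v)) (w : T → ℝ) (hw : ∀ v, 0 ≤ w v)
    (hrow : ∀ u, 0 < w u → ∑ v, M u v * w v ≤ 1) (f : T → ℝ) :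
    ∑ u, ∑ v, w u * w v * M u v * (f u - f v) ^ 2 ≤ 2 * ∑ u, w u * f u ^ 2 := by
  have h1 : ∑ u, ∑ v, w u * w v * M u v * f u ^ 2 ≤ ∑ u, w u * f u ^ 2 := by
    refine sum_le_sum fun u _ => ?_
    have h : ∑ v, w u * w v * M u v * f u ^ 2 = w u * f u ^ 2 * ∑ v, M u v * w v := by
      rw [mul_sum]
      exact sum_congr rfl fun _ _ => by ring
    rw [h]
    rcases (hw u).eq_or_lt with h0 | h0
    · simp [← h0]
    · exact mul_le_of_le_one_right (by positivity) (hrow u h0)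
  have h2 : ∑ u, ∑ v, w u * w v * M u v * f v ^ 2 = ∑ u, ∑ v, w u * w v * M u v * f u ^ 2 := by
    rw [sum_comm]
    exact sum_congr rfl fun u _ => sum_congr rfl fun v _ => by rw [hM v u]; ring
  have h3 := hpsd fun u => w u * f u
  have h4 : ∑ u, ∑ v, w u * w v * M u v * (f u - f v) ^ 2 =
      ∑ u, ∑ v, w u * w v * M u v * f u ^ 2 + ∑ u, ∑ v, w u * w v * M u v * f v ^ 2
        - 2 * ∑ u, ∑ v, M u v * ((w u * f u) * (w v * f v)) := by
    simp only [mul_sum, ← sum_add_distrib, ← sum_sub_distrib]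
    exact sum_congr rfl fun u _ => sum_congr rfl fun v _ => by ring
  linarith

variable [LinearOrder T]

lemma sum_pairs_eq (w : T → ℝ) (M : T → T → ℝ) (φ : Finset T → ℝ) :
    ∑ τ : Finset T, (∏ v ∈ τ, w v) * ∑ u ∈ τ, ∑ v ∈ τ.erase u, M u v *
      (incidenceSign u (τ.erase u) * φ (τ.erase u) +
        incidenceSign v (τ.erase v) * φ (τ.erase v)) ^ 2 =
    ∑ ρ : Finset T, (∏ v ∈ ρ, w v) * ∑ v ∈ ρᶜ, ∑ u ∈ (insert v ρ)ᶜ, w u * w v * M u v *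
      (incidenceSign u ρ * φ (insert u ρ) - incidenceSign v ρ * φ (insert v ρ)) ^ 2 := by
  let g : T → T → Finset T → ℝ := fun u v ρ => (∏ v ∈ ρ, w v) * (w u * w v * M u v *
      (incidenceSign u ρ * φ (insert u ρ) - incidenceSign v ρ * φ (insert v ρ)) ^ 2)
  calc _ = ∑ τ : Finset T, ∑ u ∈ τ, ∑ v ∈ τ.erase u, g u v ((τ.erase u).erase v) := ?_
    _ = ∑ σ : Finset T, ∑ u ∈ σᶜ, ∑ v ∈ σ, g u v (σ.erase v) :=
        sum_sum_mem_eq_sum_sum_compl fun u σ => ∑ v ∈ σ, g u v (σ.erase v)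
    _ = ∑ σ : Finset T, ∑ v ∈ σ, ∑ u ∈ (insert v (σ.erase v))ᶜ, g u v (σ.erase v) :=
        sum_congr rfl fun σ _ => by
          rw [sum_comm]
          exact sum_congr rfl fun v hv => by rw [insert_erase hv]
    _ = ∑ ρ : Finset T, ∑ v ∈ ρᶜ, ∑ u ∈ (insert v ρ)ᶜ, g u v ρ :=
        sum_sum_mem_eq_sum_sum_compl fun v ρ => ∑ u ∈ (insert v ρ)ᶜ, g u v ρ
    _ = _ := by simp only [g, mul_sum]
  refine sum_congr rfl fun τ _ => ?_
  simp only [mul_sum]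
  refine sum_congr rfl fun u hu => sum_congr rfl fun v hv => ?_
  obtain ⟨hvu, hvτ⟩ := mem_erase.1 hv
  simp only [g]
  set ρ := (τ.erase u).erase v with hρ
  have hv' : v ∉ ρ := notMem_erase _ _
  have hu' : u ∉ ρ := fun h => notMem_erase u τ (mem_of_mem_erase h)
  have h1 : τ.erase u = insert v ρ := (insert_erase hv).symm
  have h2 : τ.erase v = insert u ρ := by
    rw [hρ, erase_right_comm, insert_erase (mem_erase.2 ⟨hvu.symm, hu⟩)]
  have hw : ∏ v ∈ τ, w v = w u * (w v * ∏ v ∈ ρ, w v) := by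
    rw [← insert_erase hu, prod_insert (notMem_erase _ _), h1, prod_insert hv']
  rw [h1, h2, hw]
  have hs := incidenceSign_swap hvu.symm hu' hv'
  have ha := incidenceSign_sq u ρ
  have hb := incidenceSign_sq v (insert u ρ)
  have hc := incidenceSign_sq v ρ
  have hd := incidenceSign_sq u (insert v ρ)
  generalize incidenceSign u ρ = a at *
  generalize incidenceSign v (insert u ρ) = b at *
  generalize incidenceSign v ρ = c at *
  generalize incidenceSign u (insert v ρ) = d at *
  have key : d * b = -(a * c) := by linear_combination (-(d * b)) * ha + a * d * hs - a * c * hd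
  have : (d * φ (insert v ρ) + b * φ (insert u ρ)) ^ 2 =
      (a * φ (insert u ρ) - c * φ (insert v ρ)) ^ 2 := by
    linear_combination (φ (insert v ρ)) ^ 2 * (hd - hc) + (φ (insert u ρ)) ^ 2 * (hb - ha) +
      2 * φ (insert v ρ) * φ (insert u ρ) * key
  rw [this]
  ring

/-- The vanishing of harmonic cochains of the independence complex of `G` in a degree which is
small compared with the total weight of a fractional packing. -/
lemma prod_mul_sq_eq_zero_of_harmonic (G : T → T → Prop) (M : T → T → ℝ)
    (hM : ∀ u v, M u v = M v u)
    (hM0 : ∀ u v, 0 ≤ M u v) (hG : ∀ u v, G u v → 1 ≤ M u v)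
    (hpsd : ∀ g : T → ℝ, 0 ≤ ∑ u, ∑ v, M u v * (g u * g v)) (w : T → ℝ) (hw : ∀ v, 0 ≤ w v)
    (hrow : ∀ u, 0 < w u → ∑ v, M u v * w v ≤ 1) {n : ℕ} (hn : (n : ℝ) < ∑ v, w v)
    (φ : Finset T → ℝ)
    (hφ : ∀ σ, φ σ ≠ 0 → ((σ : Set T).Pairwise fun u v => ¬ G u v) ∧ #σ = n)
    (hcycle : contract w φ = 0)
    (hcocycle : ∀ τ : Finset T, ((τ : Set T).Pairwise fun u v => ¬ G u v) →
      (∏ v ∈ τ, w v) ≠ 0 → coboundary φ τ = 0) (σ : Finset T) :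
    (∏ v ∈ σ, w v) * φ σ ^ 2 = 0 := by
  have hprod : ∀ σ : Finset T, 0 ≤ ∏ v ∈ σ, w v := fun σ => prod_nonneg fun v _ => hw v
  have hA : ∑ τ, (∏ v ∈ τ, w v) * coboundary φ τ ^ 2 =
      (∑ v, w v) * ∑ σ, (∏ v ∈ σ, w v) * φ σ ^ 2 := by
    have h := sum_mul_coboundary w φ (coboundary φ)
    calc _ = ∑ τ, (∏ v ∈ τ, w v) * coboundary φ τ * coboundary φ τ :=
          sum_congr rfl fun _ _ => by ring
      _ = _ := h
      _ = _ := by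
        rw [mul_sum]
        refine sum_congr rfl fun σ _ => ?_
        have := contract_coboundary_add w φ σ
        rw [hcycle] at this
        have h0 : coboundary (0 : Finset T → ℝ) σ = 0 := by simp [coboundary]
        rw [h0, add_zero] at this
        rw [this]
        ring
  have hB : 2 * ∑ τ, (∏ v ∈ τ, w v) * coboundary φ τ ^ 2 ≤
      ∑ τ : Finset T, (∏ v ∈ τ, w v) * ∑ u ∈ τ, ∑ v ∈ τ.erase u, M u v *
      (incidenceSign u (τ.erase u) * φ (τ.erase u) +
        incidenceSign v (τ.erase v) * φ (τ.erase v)) ^ 2 := by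
    rw [mul_sum]
    refine sum_le_sum fun τ _ => ?_
    by_cases h0 : ∏ v ∈ τ, w v = 0
    · simp [h0]
    by_cases hτ : (τ : Set T).Pairwise fun u v => ¬ G u v
    · rw [hcocycle τ hτ h0]
      simp only [ne_eq, OfNat.ofNat_ne_zero, not_false_eq_true, zero_pow, mul_zero]
      exact mul_nonneg (hprod τ) (sum_nonneg fun u _ => sum_nonneg fun v _ =>
        mul_nonneg (hM0 u v) (sq_nonneg _))
    · rw [mul_left_comm]
      exact mul_le_mul_of_nonneg_left
        (coboundary_sq_le G M hM hM0 hG φ (fun σ h => (hφ σ h).1) τ hτ) (hprod τ)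
  have hC : ∑ ρ : Finset T, (∏ v ∈ ρ, w v) * ∑ v ∈ ρᶜ, ∑ u ∈ (insert v ρ)ᶜ, w u * w v * M u v *
      (incidenceSign u ρ * φ (insert u ρ) - incidenceSign v ρ * φ (insert v ρ)) ^ 2 ≤
      2 * ∑ ρ : Finset T, ∑ u ∈ ρᶜ, (∏ v ∈ insert u ρ, w v) * φ (insert u ρ) ^ 2 := by
    rw [mul_sum]
    refine sum_le_sum fun ρ _ => ?_
    let f : T → ℝ := fun u => if u ∈ ρᶜ then incidenceSign u ρ * φ (insert u ρ) else 0
    have hf : ∀ u ∈ ρᶜ, f u = incidenceSign u ρ * φ (insert u ρ) := fun u hu => if_pos hu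
    have hnn : ∀ u v, 0 ≤ w u * w v * M u v * (f u - f v) ^ 2 := fun u v =>
      mul_nonneg (mul_nonneg (mul_nonneg (hw u) (hw v)) (hM0 u v)) (sq_nonneg _)
    have h1 : ∑ v ∈ ρᶜ, ∑ u ∈ (insert v ρ)ᶜ, w u * w v * M u v *
        (incidenceSign u ρ * φ (insert u ρ) - incidenceSign v ρ * φ (insert v ρ)) ^ 2 ≤
        ∑ v, ∑ u, w u * w v * M u v * (f u - f v) ^ 2 := by
      calc _ = ∑ v ∈ ρᶜ, ∑ u ∈ (insert v ρ)ᶜ, w u * w v * M u v * (f u - f v) ^ 2 := by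
            refine sum_congr rfl fun v hv => sum_congr rfl fun u hu => ?_
            rw [hf v hv, hf u (compl_subset_compl.2 (subset_insert _ _) hu)]
        _ ≤ ∑ v ∈ ρᶜ, ∑ u, w u * w v * M u v * (f u - f v) ^ 2 :=
            sum_le_sum fun v _ => sum_le_univ_sum_of_nonneg fun u => hnn u v
        _ ≤ _ := sum_le_univ_sum_of_nonneg fun v => sum_nonneg fun u _ => hnn u v
    have h2 := sum_mul_sub_sq_le M hM hpsd w hw hrow f
    rw [sum_comm] at h2
    have h3 : ∑ u, w u * f u ^ 2 = ∑ u ∈ ρᶜ, w u * φ (insert u ρ) ^ 2 := by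
      symm
      rw [← sum_subset (subset_univ ρᶜ)]
      · refine sum_congr rfl fun u hu => ?_
        rw [hf u hu, mul_pow, incidenceSign_sq, one_mul]
      · intro u _ hu
        simp only [f, if_neg hu]
        ring
    rw [h3] at h2
    have h4 : ∑ u ∈ ρᶜ, (∏ v ∈ insert u ρ, w v) * φ (insert u ρ) ^ 2 =
        (∏ v ∈ ρ, w v) * ∑ u ∈ ρᶜ, w u * φ (insert u ρ) ^ 2 := by
      rw [mul_sum]
      refine sum_congr rfl fun u hu => ?_
      rw [prod_insert (mem_compl.1 hu)]
      ring
    rw [h4, mul_left_comm]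
    exact mul_le_mul_of_nonneg_left (h1.trans h2) (hprod ρ)
  have hD : ∑ ρ : Finset T, ∑ u ∈ ρᶜ, (∏ v ∈ insert u ρ, w v) * φ (insert u ρ) ^ 2 =
      n * ∑ σ, (∏ v ∈ σ, w v) * φ σ ^ 2 := by
    rw [← sum_sum_mem_eq_sum_sum_compl fun u (ρ : Finset T) =>
      (∏ v ∈ insert u ρ, w v) * φ (insert u ρ) ^ 2, mul_sum]
    refine sum_congr rfl fun σ _ => ?_
    rw [sum_congr rfl fun u hu => by rw [insert_erase hu], sum_const, nsmul_eq_mul]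
    by_cases h0 : φ σ = 0
    · simp [h0]
    · rw [(hφ σ h0).2]
  rw [sum_pairs_eq] at hB
  have hnn : ∀ σ : Finset T, 0 ≤ (∏ v ∈ σ, w v) * φ σ ^ 2 := fun σ =>
    mul_nonneg (hprod σ) (sq_nonneg _)
  have hQ : 0 ≤ ∑ σ, (∏ v ∈ σ, w v) * φ σ ^ 2 := sum_nonneg fun σ _ => hnn σ
  have hQ0 : ∑ σ, (∏ v ∈ σ, w v) * φ σ ^ 2 = 0 := by
    by_contra h
    have := hQ.lt_of_ne (Ne.symm h)
    nlinarith
  exact (sum_eq_zero_iff_of_nonneg fun σ _ => hnn σ).1 hQ0 σ (mem_univ σ)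

/-- `σ` is an `n`-element subset of `S` which is independent in `G`. -/
def IsIndependentFace (G : T → T → Prop) (S : Set T) (n : ℕ) (σ : Finset T) : Prop :=
  ((σ : Set T).Pairwise fun u v => ¬ G u v) ∧ #σ = n ∧ ∀ v ∈ σ, v ∈ S

lemma isIndependentFace_of_contract_ne_zero {G : T → T → Prop} {S : Set T} {n : ℕ}
    {c : Finset T → ℝ} (hc : ∀ σ, c σ ≠ 0 → IsIndependentFace G S (n + 1) σ) {w : T → ℝ}
    {σ : Finset T} (hσ : contract w c σ ≠ 0) : IsIndependentFace G S n σ := by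
  rw [contract_apply] at hσ
  obtain ⟨v, hv, h⟩ := exists_ne_zero_of_sum_ne_zero hσ
  obtain ⟨h1, h2, h3⟩ := hc _ (right_ne_zero_of_mul (right_ne_zero_of_mul h))
  rw [card_insert_of_notMem (mem_compl.1 hv)] at h2
  exact ⟨h1.mono (coe_subset.2 (subset_insert _ _)), by omega,
    fun u hu => h3 u (mem_insert_of_mem hu)⟩

/-- Cycles of the independence complex of `G` of small degree are boundaries. -/
lemma exists_contract_eq_of_contract_eq_zero (G : T → T → Prop) (M : T → T → ℝ)
    (hM : ∀ u v, M u v = M v u)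
    (hM0 : ∀ u v, 0 ≤ M u v) (hG : ∀ u v, G u v → 1 ≤ M u v)
    (hpsd : ∀ g : T → ℝ, 0 ≤ ∑ u, ∑ v, M u v * (g u * g v)) (w : T → ℝ) (hw : ∀ v, 0 ≤ w v)
    (hrow : ∀ u, 0 < w u → ∑ v, M u v * w v ≤ 1) {n : ℕ} (hn : (n : ℝ) < ∑ v, w v)
    (z : Finset T → ℝ) (hz : ∀ σ, z σ ≠ 0 → IsIndependentFace G {v | 0 < w v} n σ)
    (hz0 : contract 1 z = 0) :
    ∃ c : Finset T → ℝ, (∀ σ, c σ ≠ 0 → IsIndependentFace G {v | 0 < w v} (n + 1) σ) ∧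
      contract 1 c = z := by
  let C : Submodule ℝ (Finset T → ℝ) :=
    { carrier := {c | ∀ σ, c σ ≠ 0 → IsIndependentFace G {v | 0 < w v} (n + 1) σ}
      zero_mem' := fun σ h => (h rfl).elim
      add_mem' := fun {a b} ha hb σ h => by
        by_cases h0 : a σ = 0
        · exact hb σ fun h1 => h (by simp [h0, h1])
        · exact ha σ h0
      smul_mem' := fun r a ha σ h => ha σ (right_ne_zero_of_mul h) }
  let p : Finset T → ℝ := fun σ => if ∏ v ∈ σ, w v = 0 then 1 else (∏ v ∈ σ, w v)⁻¹
  have hprod : ∀ σ : Finset T, 0 ≤ ∏ v ∈ σ, w v := fun σ => prod_nonneg fun v _ => hw v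
  have hp : ∀ σ, 0 < p σ := by
    intro σ
    simp only [p]
    split_ifs with h
    · exact one_pos
    · exact inv_pos.2 ((hprod σ).lt_of_ne (Ne.symm h))
  obtain ⟨b, hb, horth⟩ := exists_mem_forall_weighted_orthogonal p hp (C.map (contract 1)) z
  obtain ⟨c, hc, rfl⟩ := Submodule.mem_map.1 hb
  refine ⟨c, hc, ?_⟩
  set h : Finset T → ℝ := z - contract 1 c with hh
  have hface : ∀ σ, h σ ≠ 0 → IsIndependentFace G {v | 0 < w v} n σ := by
    intro σ hσ
    by_cases h0 : z σ = 0
    · exact isIndependentFace_of_contract_ne_zero (w := 1) hc fun h1 => hσ (by simp [hh, h0, h1])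
    · exact hz σ h0
  have hcyc : contract 1 h = 0 := by rw [hh, map_sub, hz0, contract_contract, sub_zero]
  let φ : Finset T → ℝ := fun σ => p σ * h σ
  have hφface : ∀ σ, φ σ ≠ 0 → IsIndependentFace G {v | 0 < w v} n σ :=
    fun σ hσ => hface σ (right_ne_zero_of_mul hσ)
  have hprod_ne : ∀ σ, h σ ≠ 0 → ∏ v ∈ σ, w v ≠ 0 := fun σ hσ =>
    (prod_pos fun v hv => (hface σ hσ).2.2 v hv).ne'
  have hφ : ∀ σ, (∏ v ∈ σ, w v) * φ σ = h σ := by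
    intro σ
    by_cases h0 : h σ = 0
    · simp [φ, h0]
    · have := hprod_ne σ h0
      simp only [φ, p, if_neg this]
      field_simp
  have key := prod_mul_sq_eq_zero_of_harmonic G M hM hM0 hG hpsd w hw hrow hn φ
    (fun σ hσ => ⟨(hφface σ hσ).1, (hφface σ hσ).2.1⟩) ?_ ?_
  · ext σ
    by_contra hne
    have h0 : h σ ≠ 0 := fun h0 => hne (sub_eq_zero.1 h0).symm
    have h1 : φ σ ≠ 0 := mul_ne_zero (hp σ).ne' h0
    exact mul_ne_zero (hprod_ne σ h0) (pow_ne_zero 2 h1) (key σ)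
  · ext ρ
    by_cases h0 : ∏ v ∈ ρ, w v = 0
    · rw [contract_apply]
      refine sum_eq_zero fun v _ => ?_
      by_cases h1 : φ (insert v ρ) = 0
      · simp [h1]
      · exact ((prod_pos fun u hu =>
          (hφface _ h1).2.2 u (mem_insert_of_mem hu)).ne' h0).elim
    · refine (mul_eq_zero.1 ?_).resolve_left h0
      rw [← show contract 1 h ρ = 0 from congrFun hcyc ρ, contract_apply, contract_apply, mul_sum]
      refine sum_congr rfl fun v hv => ?_
      rw [← hφ (insert v ρ), prod_insert (mem_compl.1 hv), Pi.one_apply]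
      ring
  · intro τ hτ hτ0
    by_cases hcard : #τ = n + 1
    · have hmem : (Pi.single τ 1 : Finset T → ℝ) ∈ C := by
        intro σ hσ
        obtain rfl : σ = τ := by
          by_contra hne
          exact hσ (Pi.single_eq_of_ne hne _)
        exact ⟨hτ, hcard, fun v hv => (hw v).lt_of_ne' (prod_ne_zero_iff.1 hτ0 v hv)⟩
      have h1 := horth _ (Submodule.mem_map_of_mem hmem)
      have h2 := sum_mul_coboundary 1 φ (Pi.single τ 1)
      have h3 : ∑ σ : Finset T, (∏ v ∈ σ, (1 : T → ℝ) v) * contract 1 (Pi.single τ 1) σ * φ σ =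
          0 := by
        rw [← h1]
        refine sum_congr rfl fun σ _ => ?_
        simp only [Pi.one_apply, prod_const_one, one_mul, φ, hh, Pi.sub_apply]
        ring
      rw [h3] at h2
      simpa [Pi.single_apply] using h2
    · refine sum_eq_zero fun u hu => ?_
      by_cases h0 : φ (τ.erase u) = 0
      · simp [h0]
      · have := (hφface _ h0).2.1
        have := card_erase_add_one hu
        omega

end IndependenceComplex

section Rainbow

variable {T κ : Type*} [LinearOrder κ]

/-- The sum of the coefficients of a chain over the faces whose set of colours is `I`. -/
def rainbowSum [Fintype T] (col : T → κ) (I : Finset κ) : (Finset T → ℝ) →ₗ[ℝ] ℝ where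
  toFun c := ∑ σ : Finset T, if σ.image col = I then c σ else 0
  map_add' c d := by simp [← sum_filter, sum_add_distrib]
  map_smul' a c := by simp [mul_sum]

lemma rainbowSum_apply [Fintype T] (col : T → κ) (I : Finset κ) (c : Finset T → ℝ) :
    rainbowSum col I c = ∑ σ : Finset T, if σ.image col = I then c σ else 0 := rfl

lemma rainbowSum_eq_zero [Fintype T] {col : T → κ} {I : Finset κ} {j : κ} (hj : j ∈ I)
    {c : Finset T → ℝ} (hc : ∀ σ, c σ ≠ 0 → ∀ v ∈ σ, col v ≠ j) : rainbowSum col I c = 0 := by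
  rw [rainbowSum_apply]
  refine sum_eq_zero fun σ _ => ?_
  split_ifs with h
  · by_contra h0
    obtain ⟨v, hv, hvj⟩ := mem_image.1 (h ▸ hj)
    exact hc σ h0 v hv hvj
  · rfl

variable [LinearOrder T]

lemma incidenceSign_image {col : T → κ} (hcol : Monotone col) {σ : Finset T} {v : T}
    (hinj : Set.InjOn col σ) (hv : col v ∉ σ.image col) :
    incidenceSign v σ = incidenceSign (col v) (σ.image col) := by
  have h : {i ∈ σ.image col | i < col v} = {x ∈ σ | x < v}.image col := by
    rw [filter_image]
    congr 1
    refine filter_congr fun x hx => ?_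
    have hne : col x ≠ col v := fun h => hv (h ▸ mem_image_of_mem col hx)
    refine ⟨fun h => ?_, fun h => (hcol h.le).lt_of_ne hne⟩
    by_contra h'
    exact (hcol (not_lt.1 h')).not_gt h
  rw [incidenceSign, incidenceSign, h,
    card_image_of_injOn (hinj.mono (coe_subset.2 (filter_subset _ _)))]

lemma sum_incidenceSign_rainbow {col : T → κ} (hcol : Monotone col) {I : Finset κ} {i : κ}
    (hi : i ∈ I) {σ : Finset T} (hcard : #σ = #I) (hσ : ∀ v ∈ σ, col v ∈ I) :
    ∑ v ∈ σ, (if (σ.erase v).image col = I.erase i then incidenceSign v (σ.erase v) else 0) =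
      if σ.image col = I then incidenceSign i (I.erase i) else 0 := by
  have hinj : ∀ v ∈ σ, (σ.erase v).image col = I.erase i →
      Set.InjOn col (σ.erase v : Finset T) := by
    intro v hv h
    rw [← card_image_iff, h, card_erase_of_mem hi, card_erase_of_mem hv, hcard]
  by_cases hI : σ.image col = I
  · rw [if_pos hI]
    have hinjσ : Set.InjOn col (σ : Set T) := by
      rw [← card_image_iff, hI, hcard]
    obtain ⟨v, hv, rfl⟩ := mem_image.1 (hI ▸ hi)
    have himage : (σ.erase v).image col = I.erase (col v) := by
      ext j
      simp only [mem_image, mem_erase, ← hI]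
      constructor
      · rintro ⟨x, ⟨hxv, hx⟩, rfl⟩
        exact ⟨fun h => hxv (hinjσ hx hv h), x, hx, rfl⟩
      · rintro ⟨hj, x, hx, rfl⟩
        exact ⟨x, ⟨fun h => hj (h ▸ rfl), hx⟩, rfl⟩
    rw [sum_eq_single_of_mem v hv, if_pos himage, ← himage]
    · exact incidenceSign_image hcol (hinj v hv himage) (by rw [himage]; simp)
    · intro u hu huv
      refine if_neg fun h => ?_
      have : col v ∈ (σ.erase u).image col := mem_image_of_mem col (mem_erase.2 ⟨huv.symm, hv⟩)
      rw [h] at this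
      exact ne_of_mem_erase this rfl
  · rw [if_neg hI]
    by_cases hex : ∃ v ∈ σ, (σ.erase v).image col = I.erase i
    swap
    · push Not at hex
      exact sum_eq_zero fun v hv => if_neg (hex v hv)
    obtain ⟨v, hv, himage⟩ := hex
    have hσv : σ.image col = insert (col v) (I.erase i) := by
      rw [← himage, ← image_insert, insert_erase hv]
    have hvi : col v ≠ i := by
      rintro rfl
      exact hI (by rw [hσv, insert_erase hi])
    obtain ⟨u, hu, huv⟩ : ∃ u ∈ σ.erase v, col u = col v :=
      mem_image.1 (himage ▸ mem_erase.2 ⟨hvi, hσ v hv⟩)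
    obtain ⟨hne, huσ⟩ := mem_erase.1 hu
    have hsub : ({u, v} : Finset T) ⊆ σ := by simp [insert_subset_iff, huσ, hv]
    set ρ := (σ.erase v).erase u with hρ
    have h1 : σ.erase v = insert u ρ := (insert_erase hu).symm
    have h2 : σ.erase u = insert v ρ := by
      rw [hρ, erase_right_comm, insert_erase (mem_erase.2 ⟨hne.symm, hv⟩)]
    have himage' : (σ.erase u).image col = I.erase i := by
      rw [h2, image_insert, ← huv, ← image_insert, ← h1, himage]
    rw [← sum_subset hsub, sum_pair hne, if_pos himage, if_pos himage']
    · have hinjρ : Set.InjOn col (ρ : Set T) :=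
        (hinj v hv himage).mono (coe_subset.2 (erase_subset _ _))
      have huρ : col u ∉ ρ.image col := by
        rintro h
        obtain ⟨x, hx, hxu⟩ := mem_image.1 h
        obtain ⟨hxne, hx⟩ := mem_erase.1 hx
        exact hxne (hinj v hv himage hx hu hxu)
      have hs := incidenceSign_swap (ρ := ρ) hne (notMem_erase _ _)
        fun h => notMem_erase v σ (mem_of_mem_erase h)
      have ha : incidenceSign u ρ = incidenceSign v ρ := by
        rw [incidenceSign_image hcol hinjρ huρ, huv,
          ← incidenceSign_image hcol hinjρ (huv ▸ huρ)]
      rw [h1, h2]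
      have hb := incidenceSign_mul_self v ρ
      rw [ha] at hs
      linear_combination incidenceSign v ρ * hs -
        (incidenceSign u (insert v ρ) + incidenceSign v (insert u ρ)) * hb
    · intro x hx hx'
      simp only [mem_insert, mem_singleton, not_or] at hx'
      refine if_neg fun h => hne ?_
      exact hinj x hx h (mem_erase.2 ⟨Ne.symm hx'.1, huσ⟩) (mem_erase.2 ⟨Ne.symm hx'.2, hv⟩) huv

variable [Fintype T]

lemma rainbowSum_contract {col : T → κ} (hcol : Monotone col) {I : Finset κ} {i : κ}
    (hi : i ∈ I) {c : Finset T → ℝ} (hc : ∀ σ, c σ ≠ 0 → #σ = #I ∧ ∀ v ∈ σ, col v ∈ I) :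
    rainbowSum col (I.erase i) (contract 1 c) =
      incidenceSign i (I.erase i) * rainbowSum col I c := by
  rw [rainbowSum_apply, rainbowSum_apply, mul_sum]
  have h := sum_sum_mem_eq_sum_sum_compl fun v (τ : Finset T) =>
    (if τ.image col = I.erase i then incidenceSign v τ else 0) * c (insert v τ)
  calc _ = _ := sum_congr rfl fun τ _ => ?_
    _ = _ := h.symm
    _ = _ := sum_congr rfl fun σ _ => ?_
  · rw [contract_apply]
    split_ifs <;> simp
  · rw [sum_congr rfl fun v hv => by rw [insert_erase hv], ← sum_mul]
    by_cases h0 : c σ = 0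
    · simp [h0]
    · rw [sum_incidenceSign_rainbow hcol hi (hc σ h0).1 (hc σ h0).2]
      split_ifs <;> simp

lemma exists_chains_rainbowSum_eq_one {col : T → κ} (hcol : Monotone col) (G : T → T → Prop)
    (hexact : ∀ I : Finset κ, ∀ n, #I = n + 1 → ∀ z : Finset T → ℝ,
      (∀ σ, z σ ≠ 0 → IsIndependentFace G {v | col v ∈ I} n σ) → contract 1 z = 0 →
      ∃ c : Finset T → ℝ, (∀ σ, c σ ≠ 0 → IsIndependentFace G {v | col v ∈ I} (n + 1) σ) ∧
        contract 1 c = z) (n : ℕ) :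
    ∃ c : Finset κ → Finset T → ℝ, ∀ I, #I ≤ n →
      (∀ σ, c I σ ≠ 0 → IsIndependentFace G {v | col v ∈ I} #I σ) ∧
      contract 1 (c I) = ∑ i ∈ I, incidenceSign i (I.erase i) • c (I.erase i) ∧
      rainbowSum col I (c I) = 1 := by
  induction n with
  | zero =>
    refine ⟨fun _ => Pi.single ∅ 1, fun I hI => ?_⟩
    obtain rfl : I = ∅ := card_eq_zero.1 (Nat.le_zero.1 hI)
    refine ⟨fun σ hσ => ?_, ?_, ?_⟩
    · obtain rfl : σ = ∅ := by
        by_contra hne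
        exact hσ (Pi.single_eq_of_ne hne _)
      simp [IsIndependentFace]
    · ext ρ
      rw [contract_apply]
      simp [Pi.single_apply]
    · rw [rainbowSum_apply]
      simp
  | succ n ih =>
    obtain ⟨c, hc⟩ := ih
    have hcard : ∀ {I : Finset κ}, #I = n + 1 → ∀ i ∈ I, #(I.erase i) = n := fun {I} hI i hi => by
      rw [card_erase_of_mem hi, hI, Nat.add_sub_cancel]
    have hstep : ∀ I : Finset κ, ∃ d : Finset T → ℝ, #I = n + 1 →
        (∀ σ, d σ ≠ 0 → IsIndependentFace G {v | col v ∈ I} (n + 1) σ) ∧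
          contract 1 d = ∑ i ∈ I, incidenceSign i (I.erase i) • c (I.erase i) := by
      intro I
      by_cases hI : #I = n + 1
      swap
      · exact ⟨0, fun h => (hI h).elim⟩
      refine (hexact I n hI (∑ i ∈ I, incidenceSign i (I.erase i) • c (I.erase i))
        (fun σ hσ => ?_) ?_).imp fun d hd _ => hd
      · rw [Finset.sum_apply] at hσ
        obtain ⟨i, hi, h⟩ := exists_ne_zero_of_sum_ne_zero hσ
        have hf := (hc (I.erase i) (hcard hI i hi).le).1 σ (right_ne_zero_of_mul h)
        rw [hcard hI i hi] at hf
        exact ⟨hf.1, hf.2.1, fun v hv => mem_of_mem_erase (hf.2.2 v hv)⟩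
      · rw [map_sum, ← sum_incidenceSign_erase_erase I c]
        refine sum_congr rfl fun i hi => ?_
        rw [map_smul, (hc (I.erase i) (hcard hI i hi).le).2.1]
    choose d hd using hstep
    refine ⟨fun I => if #I = n + 1 then d I else c I, fun I hI => ?_⟩
    have herase : ∀ i ∈ I, (if #(I.erase i) = n + 1 then d (I.erase i) else c (I.erase i)) =
        c (I.erase i) := fun i hi => if_neg (by
      have := card_erase_add_one hi
      omega)
    beta_reduce
    rw [show ∑ i ∈ I, incidenceSign i (I.erase i) •
        (if #(I.erase i) = n + 1 then d (I.erase i) else c (I.erase i)) =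
        ∑ i ∈ I, incidenceSign i (I.erase i) • c (I.erase i) from
      sum_congr rfl fun i hi => by rw [herase i hi]]
    by_cases hIn : #I = n + 1
    swap
    · simp only [if_neg hIn]
      exact hc I (by omega)
    simp only [if_pos hIn]
    obtain ⟨hd1, hd2⟩ := hd I hIn
    rw [hIn]
    refine ⟨hd1, hd2, ?_⟩
    obtain ⟨i, hi⟩ : I.Nonempty := card_pos.1 (by omega)
    have h1 := rainbowSum_contract hcol hi (c := d I) fun σ hσ =>
      ⟨(hd1 σ hσ).2.1.trans hIn.symm, (hd1 σ hσ).2.2⟩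
    rw [hd2, map_sum, sum_eq_single_of_mem i hi, map_smul,
      (hc (I.erase i) (hcard hIn i hi).le).2.2, smul_eq_mul] at h1
    · have := incidenceSign_mul_self i (I.erase i)
      linear_combination (-incidenceSign i (I.erase i)) * h1 +
        (1 - rainbowSum col I (d I)) * this
    · intro j hj hji
      rw [map_smul, rainbowSum_eq_zero (mem_erase.2 ⟨hji, hj⟩), smul_zero]
      intro σ hσ v hv
      exact ne_of_mem_erase (((hc (I.erase j) (hcard hIn j hj).le).1 σ hσ).2.2 v hv)

end Rainbow

/-- A spectral Hall theorem: a vertex-coloured graph whose conflicts are dominated by a nonnegative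
positive semidefinite matrix has a rainbow independent set if each nonempty set `I` of colours
carries a fractional packing of total weight more than `#I - 1`. -/
theorem exists_rainbow_of_fractional_packing {T : Type*} [Fintype T] {m : ℕ} (col : T → Fin m)
    (G : T → T → Prop) (M : T → T → ℝ) (hM : ∀ u v, M u v = M v u)
    (hM0 : ∀ u v, 0 ≤ M u v) (hG : ∀ u v, G u v → 1 ≤ M u v)
    (hpsd : ∀ g : T → ℝ, 0 ≤ ∑ u, ∑ v, M u v * (g u * g v))
    (hpack : ∀ I : Finset (Fin m), I.Nonempty → ∃ w : T → ℝ, (∀ v, 0 ≤ w v) ∧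
      (∀ v, 0 < w v ↔ col v ∈ I) ∧ (∀ u, 0 < w u → ∑ v, M u v * w v ≤ 1) ∧
      (#I : ℝ) - 1 < ∑ v, w v) :
    ∃ E : Fin m → T, (∀ i, col (E i) = i) ∧ ∀ i j, i ≠ j → ¬ G (E i) (E j) := by
  let _ : LinearOrder T := LinearOrder.lift' (fun x => toLex (col x, Fintype.equivFin T x))
    fun x y h => (Fintype.equivFin T).injective (congrArg (fun p => (ofLex p).2) h)
  have hcol : Monotone col := fun x y h =>
    Prod.Lex.monotone_fst (toLex (col x, Fintype.equivFin T x))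
      (toLex (col y, Fintype.equivFin T y)) h
  obtain ⟨c, hc⟩ := exists_chains_rainbowSum_eq_one hcol G (fun I n hI z hz hz0 => by
    obtain ⟨w, hw, hwI, hrow, hsum⟩ := hpack I (card_pos.1 (by omega))
    have hS : {v | col v ∈ I} = {v | 0 < w v} := by
      ext v
      exact (hwI v).symm
    rw [hS] at hz ⊢
    refine exists_contract_eq_of_contract_eq_zero G M hM hM0 hG hpsd w hw hrow ?_ z hz hz0
    rw [hI] at hsum
    push_cast at hsum
    linarith) m
  obtain ⟨h1, -, h2⟩ := hc univ (by simp)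
  obtain ⟨σ, -, hσ⟩ := exists_ne_zero_of_sum_ne_zero
    (h2.trans_ne one_ne_zero : (∑ σ : Finset T, if σ.image col = univ then c univ σ else 0) ≠ 0)
  obtain ⟨himage, hσ⟩ := ite_ne_right_iff.1 hσ
  have : ∀ i, ∃ v ∈ σ, col v = i := fun i => mem_image.1 (himage ▸ mem_univ i)
  choose E hE hEi using this
  refine ⟨E, hEi, fun i j hij => (h1 σ hσ).1 (hE i) (hE j) fun h => hij ?_⟩
  rw [← hEi i, h, hEi j]

lemma sum_card_inter_mul_nonneg {T V : Type*} [Fintype T] [DecidableEq V] (e : T → Finset V)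
    (g : T → ℝ) : 0 ≤ ∑ u, ∑ v, (#(e u ∩ e v) : ℝ) * (g u * g v) := by
  let U : Finset V := univ.biUnion e
  have hcard : ∀ u v, (#(e u ∩ e v) : ℝ) =
      ∑ a ∈ U, (if a ∈ e u then 1 else 0) * (if a ∈ e v then 1 else 0) := by
    intro u v
    have : e u ∩ e v = {a ∈ U | a ∈ e u ∧ a ∈ e v} := by
      ext a
      simp only [U, mem_inter, mem_filter, mem_biUnion, mem_univ, true_and]
      exact ⟨fun h => ⟨⟨u, h.1⟩, h⟩, fun h => h.2⟩
    rw [this, ← sum_boole]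
    refine sum_congr rfl fun a _ => ?_
    by_cases h1 : a ∈ e u <;> by_cases h2 : a ∈ e v <;> simp [h1, h2]
  have : ∑ u, ∑ v, (#(e u ∩ e v) : ℝ) * (g u * g v) =
      ∑ a ∈ U, (∑ u, (if a ∈ e u then 1 else 0) * g u) ^ 2 := by
    simp only [hcard, sum_mul]
    rw [sum_congr rfl fun u _ => sum_comm, sum_comm]
    refine sum_congr rfl fun a _ => ?_
    rw [sq, sum_mul_sum]
    exact sum_congr rfl fun u _ => sum_congr rfl fun v _ => by ring
  rw [this]
  exact sum_nonneg fun a _ => sq_nonneg _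

lemma fracWidth_le_of_cover {V ι : Type*} [DecidableEq V] [Fintype ι] (F : Finset (Finset V))
    (e : ι → Finset V) (he : ∀ x, e x ∈ F) (he' : ∀ E ∈ F, ∃ x, e x = E) (a : ι → ℝ)
    (ha : ∀ x, 0 ≤ a x) (hcover : ∀ x, 1 ≤ ∑ y, (#(e x ∩ e y) : ℝ) * a y) :
    fracWidth F ≤ ENNReal.ofReal (∑ x, a x) := by
  let f : Finset V → ℝ := fun E => ∑ x, if e x = E then a x else 0
  have hf : ∀ g : Finset V → ℝ, ∑ E ∈ F, f E * g E = ∑ x, a x * g (e x) := by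
    intro g
    simp only [f, sum_mul]
    rw [sum_comm]
    exact sum_congr rfl fun x _ => by simp [ite_mul, he x]
  refine sInf_le ⟨f, fun E => sum_nonneg fun x _ => ?_, fun E hE => ?_, ?_⟩
  · split_ifs
    exacts [ha x, le_rfl]
  · obtain ⟨x, rfl⟩ := he' E hE
    rw [hf fun F' => (#(e x ∩ F') : ℝ)]
    simpa only [mul_comm] using hcover x
  · have := hf fun _ => 1
    simp only [mul_one] at this
    rw [this]

/-- **Theorem 1.5** (Aharoni–Berger–Meshulam): if hypergraphs `F_1, …, F_m` on a finite
ground set `V` satisfy `w*(⋃_{i∈I} F_i) > |I| − 1` for every nonempty `I ⊆ {1,…,m}`, then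
`F_1, …, F_m` have a system of disjoint representatives. -/
theorem exists_SDR_of_fracWidth {V : Type*} [DecidableEq V] (m : ℕ)
    (F : Fin m → Finset (Finset V))
    (h : ∀ I : Finset (Fin m), I.Nonempty →
      ((I.card : ℝ≥0∞) - 1) < fracWidth (I.biUnion F)) :
    ∃ E : Fin m → Finset V, (∀ i, E i ∈ F i) ∧
      ∀ i j, i ≠ j → Disjoint (E i) (E j) := by
  let e : (Σ i, F i) → Finset V := fun x => x.2
  have he₀ : ∀ x, e x ∈ F x.1 := fun x => x.2.2
  suffices ∃ E : Fin m → Σ i, F i, (∀ i, (E i).1 = i) ∧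
      ∀ i j, i ≠ j → ¬ ¬ Disjoint (e (E i)) (e (E j)) by
    obtain ⟨E, hE, hG⟩ := this
    exact ⟨fun i => e (E i), fun i => (congrArg F (hE i)).subset (he₀ (E i)),
      fun i j hij => not_not.1 (hG i j hij)⟩
  refine exists_rainbow_of_fractional_packing (fun x => x.1)
    (fun x y => ¬ Disjoint (e x) (e y)) (fun x y => (#(e x ∩ e y) : ℝ))
    (fun x y => by rw [inter_comm]) (fun x y => Nat.cast_nonneg _)
    (fun x y hxy => by
      rw [not_disjoint_iff_nonempty_inter] at hxy
      exact_mod_cast card_pos.2 hxy)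
    (sum_card_inter_mul_nonneg e) ?_
  intro I hI
  classical
  let ι := {x : Σ i, F i // x.1 ∈ I}
  have he : ∀ x : ι, e x.1 ∈ I.biUnion F := fun x => mem_biUnion.2 ⟨_, x.2, x.1.2.2⟩
  have he' : ∀ E ∈ I.biUnion F, ∃ x : ι, e x.1 = E := fun E hE => by
    obtain ⟨i, hi, hEi⟩ := mem_biUnion.1 hE
    exact ⟨⟨⟨i, ⟨E, hEi⟩⟩, hi⟩, rfl⟩
  obtain ⟨t, ht0, hst, htw⟩ := ENNReal.lt_iff_exists_real_btwn.1 (h I hI)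
  have hI1 : (1 : ℝ) ≤ #I := by exact_mod_cast card_pos.2 hI
  have hst' : (#I : ℝ) - 1 < t := by
    have : ((#I : ℝ≥0∞) - 1) = ENNReal.ofReal ((#I : ℝ) - 1) := by
      rw [ENNReal.ofReal_sub _ zero_le_one]
      simp
    rw [this] at hst
    exact (ENNReal.ofReal_lt_ofReal_iff_of_nonneg (by linarith)).1 hst
  have hcover : ∀ a : ι → ℝ, (∀ x, 0 ≤ a x) →
      (∀ x : ι, 1 ≤ ∑ y : ι, (#(e x.1 ∩ e y.1) : ℝ) * a y) → t < ∑ x, a x := by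
    intro a ha ha1
    by_contra! hle
    exact (htw.trans_le (fracWidth_le_of_cover _ (fun x : ι => e x.1) he he' a ha ha1)).not_ge
      (ENNReal.ofReal_le_ofReal hle)
  have : Nonempty ι := by
    by_contra hempty
    rw [not_nonempty_iff] at hempty
    have := hcover 0 (fun _ => le_rfl) fun x => hempty.elim x
    simp only [Pi.zero_apply, sum_const_zero] at this
    linarith
  obtain ⟨b, hb, hb1, hbs⟩ := exists_pos_fractional_packing
    (fun x y : ι => (#(e x.1 ∩ e y.1) : ℝ)) (fun x y => by rw [inter_comm])
    (fun x y => Nat.cast_nonneg _) (by linarith) hst' hcover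
  let w : (Σ i, F i) → ℝ := fun x => if hx : x.1 ∈ I then b ⟨x, hx⟩ else 0
  have hwι : ∀ x : ι, w x.1 = b x := fun x => dif_pos x.2
  have hsum : ∀ g : (Σ i, F i) → ℝ, ∑ x, g x * w x = ∑ x : ι, g x.1 * b x := by
    intro g
    rw [← sum_subset (subset_univ {x : Σ i, F i | x.1 ∈ I}) (fun x _ hx => ?_),
      sum_subtype _ (p := fun x : Σ i, F i => x.1 ∈ I) (by simp)]
    · exact sum_congr rfl fun x _ => by rw [hwι x]
    · simp only [w]
      rw [dif_neg (by simpa using hx), mul_zero]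
  have hwI : ∀ x, 0 < w x ↔ x.1 ∈ I := by
    intro x
    simp only [w]
    split_ifs with hx <;> simp [hx, hb]
  refine ⟨w, fun x => ?_, hwI, fun x hx => ?_, ?_⟩
  · simp only [w]
    split_ifs
    exacts [(hb _).le, le_rfl]
  · rw [hsum fun y => (#(e x ∩ e y) : ℝ)]
    exact hb1 ⟨x, (hwI x).1 hx⟩
  · have := hsum fun _ => 1
    simp only [one_mul] at this
    rwa [this]
end

section
/- Let G=(V,E) be a finite simple graph and let P be the vector representation of G assigning to each vertex v its edge incidence vector P(v) ∈ ℝ^E (P(v)(e) = 1 if v ∈ e, else 0). Then |P| equals the strong fractional domination number γ*_s(G); consequently Γ(G) ≥ γ*_s(G). -/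
open Finset
open scoped ENNReal
/-- The strong fractional domination number `γ*_s(G)`: the infimum of `∑_v f(v)` over
nonnegative `f : V → ℝ` with `∑_{u : uv∈E} f(u) + deg(v)·f(v) ≥ 1` for every vertex `v`
(`= ⊤` if no such `f` exists). -/
noncomputable def strongFracDom {V : Type*} [Fintype V] (G : SimpleGraph V)
    [DecidableRel G.Adj] : ℝ≥0∞ :=
  sInf {x : ℝ≥0∞ | ∃ f : V → ℝ, (∀ v, 0 ≤ f v) ∧
    (∀ v : V, 1 ≤ (∑ u ∈ G.neighborFinset v, f u) + (G.degree v : ℝ) * f v) ∧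
    x = ENNReal.ofReal (∑ v, f v)}

namespace SimpleGraph

/-- The edge incidence vector of the vertex `v`, indexed by the edges of `G`. -/
def edgeIncidenceVec {V : Type*} [DecidableEq V] (G : SimpleGraph V) [Fintype G.edgeSet]
    (v : V) (e : G.edgeFinset) : ℝ :=
  if v ∈ (e : Sym2 V) then 1 else 0

section EdgeIncidence

variable {V : Type*} [Fintype V] [DecidableEq V] (G : SimpleGraph V) [DecidableRel G.Adj]

theorem sum_edgeIncidenceVec_mul (u v : V) :
    ∑ e, G.edgeIncidenceVec u e * G.edgeIncidenceVec v e =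
      #{e ∈ G.edgeFinset | u ∈ e ∧ v ∈ e} := by
  have h := Finset.sum_coe_sort G.edgeFinset
    (fun e => if u ∈ e ∧ v ∈ e then (1 : ℝ) else 0)
  rw [← Finset.sum_boole, ← h]
  refine Finset.sum_congr rfl fun e _ => ?_
  simp only [edgeIncidenceVec]
  split_ifs <;> simp_all

theorem sum_edgeIncidenceVec_mul_self (v : V) :
    ∑ e, G.edgeIncidenceVec v e * G.edgeIncidenceVec v e = G.degree v := by
  rw [sum_edgeIncidenceVec_mul, ← G.card_incidenceFinset_eq_degree v, incidenceFinset_eq_filter]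
  simp only [and_self]

theorem sum_edgeIncidenceVec_mul_of_ne {u v : V} (huv : u ≠ v) :
    ∑ e, G.edgeIncidenceVec u e * G.edgeIncidenceVec v e = if G.Adj u v then 1 else 0 := by
  have h : {e ∈ G.edgeFinset | u ∈ e ∧ v ∈ e} = if G.Adj u v then {s(u, v)} else ∅ := by
    ext e
    simp only [Finset.mem_filter, mem_edgeFinset, Sym2.mem_and_mem_iff huv]
    split_ifs with h
    · simp only [Finset.mem_singleton, and_iff_right_iff_imp]
      rintro rfl
      exact h
    · simp only [Finset.notMem_empty, iff_false, not_and]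
      rintro he rfl
      exact h he
  rw [sum_edgeIncidenceVec_mul, h]
  split_ifs <;> simp

theorem isVectorRep_edgeIncidenceVec : G.IsVectorRep G.edgeIncidenceVec := by
  refine ⟨fun u v h => ?_, fun u v _ => ?_⟩
  · rw [G.sum_edgeIncidenceVec_mul_of_ne h.ne, if_pos h]
  · rw [sum_edgeIncidenceVec_mul]
    positivity

theorem sum_mul_sum_edgeIncidenceVec_mul (α : V → ℝ) (u : V) :
    ∑ v, α v * ∑ e, G.edgeIncidenceVec v e * G.edgeIncidenceVec u e =
      (∑ v ∈ G.neighborFinset u, α v) + G.degree u * α u := by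
  have h : ∀ v, α v * ∑ e, G.edgeIncidenceVec v e * G.edgeIncidenceVec u e =
      (if G.Adj u v then α v else 0) + if v = u then G.degree u * α u else 0 := by
    intro v
    rcases eq_or_ne v u with rfl | hvu
    · rw [sum_edgeIncidenceVec_mul_self]
      simp [mul_comm]
    · rw [G.sum_edgeIncidenceVec_mul_of_ne hvu]
      simp [hvu, G.adj_comm u v]
  rw [Finset.sum_congr rfl fun v _ => h v, Finset.sum_add_distrib, ← Finset.sum_filter,
    ← neighborFinset_eq_filter]
  simp

theorem repValue_edgeIncidenceVec : repValue G.edgeIncidenceVec = strongFracDom G := by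
  simp only [repValue, strongFracDom, sum_mul_sum_edgeIncidenceVec_mul]

end EdgeIncidence

/-- The index type of a vector representation may be any finite type. -/
theorem IsVectorRep.repValue_le_vecGamma {V ι : Type*} [Fintype V] [Fintype ι]
    {G : SimpleGraph V} {P : V → ι → ℝ} (hP : G.IsVectorRep P) : repValue P ≤ G.vecGamma := by
  have h (u v : V) : ∑ i, P u ((Fintype.equivFin ι).symm i) * P v ((Fintype.equivFin ι).symm i) =
      ∑ i, P u i * P v i :=
    (Fintype.equivFin ι).symm.sum_comp fun i => P u i * P v i
  refine le_sSup ⟨Fintype.card ι, fun v i => P v ((Fintype.equivFin ι).symm i), ?_, ?_⟩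
  · simpa only [IsVectorRep, h] using hP
  · simp only [repValue, h]

end SimpleGraph

/-- The assignment sending each vertex `v` of `G` to its edge incidence vector in `ℝ^E` is a
vector representation of `G` whose value is the strong fractional domination number
`γ*_s(G)`; consequently `Γ(G) ≥ γ*_s(G)`. -/
theorem edge_incidence_rep {V : Type*} [Fintype V] [DecidableEq V]
    (G : SimpleGraph V) [DecidableRel G.Adj] :
    G.IsVectorRep
        (fun (v : V) (e : G.edgeFinset) => if v ∈ (e : Sym2 V) then (1 : ℝ) else 0) ∧
      repValue
          (fun (v : V) (e : G.edgeFinset) => if v ∈ (e : Sym2 V) then (1 : ℝ) else 0) =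
        strongFracDom G ∧
      strongFracDom G ≤ G.vecGamma := by
  exact ⟨G.isVectorRep_edgeIncidenceVec, G.repValue_edgeIncidenceVec,
    G.repValue_edgeIncidenceVec ▸ G.isVectorRep_edgeIncidenceVec.repValue_le_vecGamma⟩
end
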